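/- arXiv:1807.07486 — 6 statements merged into one kernel-verified Lean document; each statement's English description precedes it below -/
import Mathlib

section
/- Let (K, δ) be a differentially closed field of characteristic zero. Then there exist an infinite set T, a derivation δ' on the field L defined as the algebraic closure of the rational function field ℚ(X_t : t ∈ T) (i.e., of the fraction field of the polynomial ring ℚ[X_t : t ∈ T]), and a field isomorphism φ : K → L satisfying φ ∘ δ = δ' ∘ φ; that is, (K, δ) is differentially isomorphic over ℚ to (L, δ'). -/
/-- A derivation on a field `K`: an additive map satisfying the Leibniz rule. -/
def IsDerivation {K : Type*} [Field K] (δ : K → K) : Prop :=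
  (∀ a b : K, δ (a + b) = δ a + δ b) ∧ ∀ a b : K, δ (a * b) = δ a * b + a * δ b

/-- Blum's definition of a differentially closed field: for every `n`, every polynomial
`p` in `x₀, …, xₙ` in which `xₙ` actually occurs, and every nonzero polynomial `q` in
`x₀, …, xₙ₋₁`, there is `a` with `p(a, δ a, …, δⁿ a) = 0` and `q(a, δ a, …, δⁿ⁻¹ a) ≠ 0`. -/
def IsDiffClosed {K : Type*} [Field K] (δ : K → K) : Prop :=
  ∀ (n : ℕ) (p : MvPolynomial (Fin (n + 1)) K) (q : MvPolynomial (Fin n) K),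
    0 < p.degreeOf (Fin.last n) → q ≠ 0 →
    ∃ a : K, MvPolynomial.eval (fun i : Fin (n + 1) => δ^[(i : ℕ)] a) p = 0 ∧
      MvPolynomial.eval (fun i : Fin n => δ^[(i : ℕ)] a) q ≠ 0

section

open Polynomial

theorem exists_derivation_apply_ne_zero {F K : Type*} [Field F] [CharZero F] [Field K]
    [Algebra F K] {y : K} (hy : Transcendental F y) : ∃ D : Derivation F K K, D y ≠ 0 := by
  classical
  have hy' : AlgebraicIndepOn F id {y} := by
    rw [AlgebraicIndepOn, algebraicIndependent_unique_type_iff]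
    exact hy
  obtain ⟨s, hys, hs⟩ := exists_isTranscendenceBasis_superset hy'
  let R := MvPolynomial s F
  let : Algebra R K := (MvPolynomial.aeval ((↑) : s → K)).toAlgebra
  have : IsScalarTower F R K := .of_algHom _
  have : FaithfulSMul R K := (faithfulSMul_iff_algebraMap_injective R K).2 hs.1
  let : Algebra (FractionRing R) K := FractionRing.liftAlgebra R K
  have : IsScalarTower R (FractionRing R) K := inferInstance
  have : Algebra.IsAlgebraic (FractionRing R) K := by
    refine (hs.isAlgebraic_iff (S := FractionRing R)).2 fun i => ?_
    have h : algebraMap R K (MvPolynomial.X i) = i := MvPolynomial.aeval_X _ _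
    rw [← h, IsScalarTower.algebraMap_apply R (FractionRing R) K]
    exact isAlgebraic_algebraMap _
  have : CharZero (FractionRing R) := inferInstance
  have : Algebra.FormallyEtale (FractionRing R) K := .of_isSeparable _ _
  have : Algebra.FormallyEtale R (FractionRing R) := .of_isLocalization (nonZeroDivisors R)
  have : Algebra.FormallyEtale R K := .comp R (FractionRing R) K
  let d : Derivation F R K := MvPolynomial.mkDerivation F fun _ => 1
  let f : Ω[K⁄F] →ₗ[K] K :=
    (d.liftKaehlerDifferential.liftBaseChange K) ∘ₗ
      (KaehlerDifferential.tensorKaehlerEquivOfFormallyEtale F R K).symm.toLinearMap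
  refine ⟨f.compDer (KaehlerDifferential.D F K), ?_⟩
  have h : algebraMap R K (MvPolynomial.X ⟨y, hys rfl⟩) = y := MvPolynomial.aeval_X _ _
  rw [← h]
  simp [f, KaehlerDifferential.tensorKaehlerEquivOfFormallyEtale_symm_D_algebraMap, d,
    MvPolynomial.mkDerivation_X F (fun _ : s => (1 : K))]

/-- The field of constants of a derivation of a field. -/
def Derivation.constants {K : Type*} [Field K] (D : Derivation ℤ K K) : Subfield K where
  carrier := {x | D x = 0}
  mul_mem' {a b} ha hb := by simp_all
  one_mem' := by simp
  add_mem' {a b} ha hb := by simp_all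
  zero_mem' := by simp
  neg_mem' {a} ha := by simp_all
  inv_mem' a ha := by simp_all [Derivation.leibniz_inv]

/-- A derivation of a field is linear over its field of constants. -/
def Derivation.overConstants {K : Type*} [Field K] (D : Derivation ℤ K K) :
    Derivation D.constants K K where
  toFun := D
  map_add' := map_add D
  map_smul' c x := by
    have : D c = 0 := c.2
    simp [Subfield.smul_def, this]
  map_one_eq_zero' := by simp
  leibniz' := D.leibniz

theorem Derivation.eq_zero_of_isAlgebraic_constants {K : Type*} [Field K] [CharZero K]
    (D : Derivation ℤ K K) [Algebra.IsAlgebraic D.constants K] : D = 0 := by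
  have : Algebra.FormallyUnramified D.constants K := .of_isSeparable _ _
  have h : D.overConstants = 0 := by
    rw [← D.overConstants.liftKaehlerDifferential_comp,
      Subsingleton.elim D.overConstants.liftKaehlerDifferential 0]
    ext; simp
  ext x
  exact congr($h x)

theorem finite_derivation_of_isTranscendenceBasis {ι C K : Type*} [Finite ι] [Field C] [Field K]
    [CharZero K] [Algebra C K] {v : ι → K} (hv : IsTranscendenceBasis ℚ v) :
    Module.Finite K (Derivation C K K) := by
  let f : Derivation C K K →ₗ[K] ι → K :=
    { toFun := fun D i => D (v i)
      map_add' := fun _ _ => rfl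
      map_smul' := fun _ _ => rfl }
  refine Module.Finite.of_injective f ((injective_iff_map_eq_zero f).2 fun D hD => ?_)
  let E : Derivation ℤ K K := D.restrictScalars ℤ
  have : Algebra.IsAlgebraic E.constants K :=
    (hv.isAlgebraic_iff (S := E.constants)).2 fun i =>
      isAlgebraic_algebraMap (⟨v i, congr($hD i)⟩ : E.constants)
  ext x
  exact congr($(E.eq_zero_of_isAlgebraic_constants) x)

theorem exists_deriv_eq_of_isAlgebraic {F K : Type*} [Field F] [Field K] [CharZero F]
    [Algebra F K] [Differential F] [Differential K] [DifferentialAlgebra F K] {y : K}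
    (hy : IsAlgebraic F y) {g : F} (h : Differential.deriv y = algebraMap F K g) :
    ∃ z : F, Differential.deriv z = g := by
  set p := minpoly F y
  have hm : p.Monic := minpoly.monic hy.isIntegral
  have hn : 0 < p.natDegree := minpoly.natDegree_pos hy.isIntegral
  set q := Differential.mapCoeffs p + derivative p * C g with hq
  have hq0 : aeval y q = 0 := by
    have := Differential.deriv_aeval_eq y p
    simpa [p, h, hq] using this.symm
  have hdeg : q.degree < p.degree := by
    rw [degree_eq_natDegree hm.ne_zero, degree_lt_iff_coeff_zero]
    intro k hk
    rw [hq, coeff_add, Differential.coeff_mapCoeffs, coeff_mul_C, coeff_derivative,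
      coeff_eq_zero_of_natDegree_lt (n := k + 1) (by omega)]
    obtain rfl | hk := hk.eq_or_lt
    · simp [hm.coeff_natDegree]
    · simp [coeff_eq_zero_of_natDegree_lt hk]
  have hz : q = 0 := by
    by_contra hne
    exact hdeg.not_ge (minpoly.degree_le_of_ne_zero F y hne hq0)
  have hc := congr(coeff $hz (p.natDegree - 1))
  rw [hq, coeff_add, Differential.coeff_mapCoeffs, coeff_mul_C, coeff_derivative,
    Nat.sub_add_cancel hn, hm.coeff_natDegree] at hc
  have hN : (p.natDegree : F) ≠ 0 := by exact_mod_cast hn.ne'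
  refine ⟨-(p.coeff (p.natDegree - 1)) * (p.natDegree : F)⁻¹, ?_⟩
  have hc' : ((p.natDegree - 1 : ℕ) : F) + 1 = p.natDegree := by
    exact_mod_cast congrArg (Nat.cast : ℕ → F) (Nat.sub_add_cancel hn)
  have hd : Differential.deriv (p.natDegree : F)⁻¹ = 0 := by simp [Derivation.leibniz_inv]
  rw [one_mul, hc', coeff_zero] at hc
  rw [Derivation.leibniz, hd, map_neg, smul_zero, zero_add, smul_eq_mul, ← div_eq_inv_mul,
    div_eq_iff hN]
  linear_combination -hc

theorem eval_eq_zero_of_residue {C : Type*} [Field C] [CharZero C] {P Q A B : C[X]} {r : C}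
    (hPQ : IsCoprime P Q) (hQ : Q ≠ 0)
    (h : (derivative P * Q - P * derivative Q) * ((X - Polynomial.C r) * B) =
      Q ^ 2 * (B + (X - Polynomial.C r) * A)) : B.eval r = 0 := by
  by_contra hB
  have hQr : Q.eval r = 0 := by
    have := congr(eval r $h)
    simpa [hB] using this.symm
  have hPr : P.eval r ≠ 0 := fun hP => by
    obtain ⟨a, b, hab⟩ := hPQ
    have := congr(eval r $hab)
    simp [hP, hQr] at this
  obtain ⟨Q₁, hQ₁, hnd⟩ := exists_eq_pow_rootMultiplicity_mul_and_not_dvd Q hQ r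
  obtain ⟨k, hk⟩ := Nat.exists_eq_succ_of_ne_zero
    ((rootMultiplicity_pos hQ).2 hQr).ne'
  rw [hk] at hQ₁
  rw [dvd_iff_isRoot, IsRoot] at hnd
  have hX : (X - Polynomial.C r) ^ (k + 1) ≠ 0 := pow_ne_zero _ (X_sub_C_ne_zero r)
  have h2 : (X - Polynomial.C r) * Q₁ * derivative P * B -
      P * (((k : C[X]) + 1) * Q₁ + (X - Polynomial.C r) * derivative Q₁) * B =
      (X - Polynomial.C r) ^ (k + 1) * Q₁ ^ 2 * (B + (X - Polynomial.C r) * A) := by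
    apply mul_left_cancel₀ hX
    rw [hQ₁] at h
    simp only [derivative_mul, derivative_X_sub_C_pow, Nat.succ_eq_add_one] at h
    simp at h
    linear_combination h
  have := congr(eval r $h2)
  simp [hB, hPr, hnd] at this
  norm_cast at this

theorem transcendental_of_deriv_eq_one {C K : Type*} [Field C] [CharZero C] [Field K] [Algebra C K]
    (δ : Derivation C K K) {t : K} (ht : δ t = 1) : Transcendental C t := fun h => by
  have hs : IsSeparable C t := (minpoly.irreducible h.isIntegral).separable
  refine hs.aeval_derivative_ne_zero (minpoly.aeval C t) ?_
  simpa [ht] using (δ.map_aeval (minpoly C t) t).symm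

theorem deriv_mem_adjoin {C K : Type*} [Field C] [Field K] [Algebra C K]
    (δ : Derivation C K K) {t : K} (ht : δ t ∈ IntermediateField.adjoin C {t}) {x : K}
    (hx : x ∈ IntermediateField.adjoin C {t}) : δ x ∈ IntermediateField.adjoin C {t} := by
  induction hx using IntermediateField.adjoin_induction with
  | mem x hx => rwa [Set.mem_singleton_iff.1 hx]
  | algebraMap x => simp
  | add x y _ _ hx hy => rw [map_add]; exact add_mem hx hy
  | inv x h hx =>
    rw [Derivation.leibniz_inv, smul_eq_mul]
    exact mul_mem (neg_mem (pow_mem (inv_mem h) 2)) hx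
  | mul x y h h' hx hy =>
    rw [Derivation.leibniz, smul_eq_mul, smul_eq_mul]
    exact add_mem (mul_mem h hy) (mul_mem h' hx)

theorem exists_isCoprime_of_mem_adjoin_simple {C K : Type*} [Field C] [Field K] [Algebra C K]
    {t x : K} (hx : x ∈ IntermediateField.adjoin C {t}) :
    ∃ P Q : C[X], IsCoprime P Q ∧ Q ≠ 0 ∧ x = aeval t P / aeval t Q := by
  classical
  obtain ⟨P, Q, rfl⟩ := (IntermediateField.mem_adjoin_simple_iff C _).1 hx
  obtain h | h := eq_or_ne (aeval t Q) 0
  · exact ⟨0, 1, isCoprime_one_right, one_ne_zero, by simp [h]⟩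
  have hQ : Q ≠ 0 := fun hQ => h (by simp [hQ])
  let := EuclideanDomain.gcdMonoid C[X]
  have hg0 : GCDMonoid.gcd P Q ≠ 0 := gcd_ne_zero_of_right hQ
  have hP' := EuclideanDomain.mul_div_cancel' hg0
    (gcd_dvd_left P Q)
  have hQ' := EuclideanDomain.mul_div_cancel' hg0
    (gcd_dvd_right P Q)
  refine ⟨P / GCDMonoid.gcd P Q, Q / GCDMonoid.gcd P Q,
    isCoprime_div_gcd_div_gcd hQ, fun h0 => hQ (by rw [← hQ', h0, mul_zero]), ?_⟩
  have hg : aeval t (GCDMonoid.gcd P Q) ≠ 0 := fun h0 => h (by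
    rw [← hQ', map_mul, h0, zero_mul])
  rw [← mul_div_mul_left (aeval t (P / GCDMonoid.gcd P Q)) _ hg, ← map_mul, ← map_mul,
    hP', hQ']

theorem deriv_ne_inv_add {C K : Type*} [Field C] [Field K] [CharZero C] [Algebra C K]
    (δ : Derivation C K K) {t : K} (ht : δ t = 1) {r : C} {A B : C[X]} (hB : B.eval r ≠ 0)
    {w : K} (hw : w * aeval t B = aeval t A) {y : K}
    (hy : IsAlgebraic (IntermediateField.adjoin C {t}) y) :
    δ y ≠ (t - algebraMap C K r)⁻¹ + w := by
  intro h
  have htr := transcendental_of_deriv_eq_one δ ht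
  have hinj : Function.Injective (aeval (R := C) t) := transcendental_iff_injective.1 htr
  have hne : ∀ {P : C[X]}, P ≠ 0 → aeval t P ≠ 0 := fun hP => (map_ne_zero_iff _ hinj).2 hP
  have hB0 : aeval t B ≠ 0 := hne fun h => hB (by simp [h])
  set F := IntermediateField.adjoin C {t}
  have htF : t ∈ F := IntermediateField.mem_adjoin_simple_self C t
  have hmem : ∀ x ∈ F, δ x ∈ F := fun x => deriv_mem_adjoin δ (ht ▸ one_mem F)
  have haF (P : C[X]) : aeval t P ∈ F :=
    IntermediateField.algebra_adjoin_le_adjoin C _ (aeval_mem_adjoin_singleton C t)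
  have : CharZero F := charZero_of_injective_algebraMap (algebraMap C F).injective
  let : Differential K := ⟨δ.restrictScalars ℤ⟩
  let : Differential F := ⟨.mk' (AddMonoidHom.toIntLinearMap
    { toFun := fun x => ⟨δ x, hmem x x.2⟩
      map_zero' := by ext; simp
      map_add' := fun x y => by ext; simp }) fun x y => by ext; simp⟩
  have : DifferentialAlgebra F K := ⟨fun _ => rfl⟩
  have hg : (t - algebraMap C K r)⁻¹ + w ∈ F := by
    rw [eq_div_of_mul_eq hB0 hw]
    exact add_mem (inv_mem (sub_mem htF (F.algebraMap_mem r))) (div_mem (haF A) (haF B))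
  obtain ⟨z, hz⟩ := exists_deriv_eq_of_isAlgebraic hy (g := ⟨_, hg⟩) h
  replace hz : δ (z : K) = (t - algebraMap C K r)⁻¹ + w := congr(($hz : K))
  obtain ⟨P, Q, hcop, hQ, hPQ⟩ := exists_isCoprime_of_mem_adjoin_simple z.2
  have htr : t - algebraMap C K r ≠ 0 := by
    simpa using hne (X_sub_C_ne_zero r)
  have hQ0 := hne hQ
  refine hB (eval_eq_zero_of_residue (A := A) hcop hQ (hinj ?_))
  have hmul : δ (z : K) * aeval t Q ^ 2 =
      aeval t (derivative P) * aeval t Q - aeval t P * aeval t (derivative Q) := by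
    have := congr(δ $(mul_comm _ _ |>.trans (eq_div_iff hQ0 |>.1 hPQ)))
    simp only [Derivation.leibniz, Derivation.map_aeval, ht, smul_eq_mul, mul_one] at this
    rw [hPQ] at this ⊢
    field_simp at this ⊢
    linear_combination this
  have hw' : δ (z : K) * ((t - algebraMap C K r) * aeval t B) =
      aeval t B + (t - algebraMap C K r) * aeval t A := by
    rw [hz, ← hw]
    field_simp
  simp only [map_mul, map_sub, map_add, map_pow, aeval_X, aeval_C]
  rw [← hmul, ← hw']
  ring

theorem exists_linearIndependent_and_mem_span {K V : Type*} [Field K] [AddCommGroup V]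
    [Module K V] [Module.Finite K V] (v : ℕ → V) :
    ∃ n, LinearIndependent K (fun i : Fin n => v i) ∧
      v n ∈ Submodule.span K (Set.range fun i : Fin n => v i) := by
  by_contra! h
  have hli (n : ℕ) : LinearIndependent K fun i : Fin n => v i := by
    induction n with
    | zero => exact linearIndependent_empty_type
    | succ n ih =>
      have := linearIndependent_finSnoc.2 ⟨ih, h n ih⟩
      convert this using 1
      ext i : 1
      refine Fin.lastCases ?_ (fun i => ?_) i <;> simp
  simpa using (hli (Module.finrank K V + 1)).fintype_card_le_finrank

theorem not_finite_derivation {C K : Type*} [Field C] [Field K] [CharZero C] [CharZero K]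
    [Algebra C K] (δ : Derivation C K K)
    (hconst : ∀ x, δ x = 0 → x ∈ (algebraMap C K).range) (hsurj : Function.Surjective δ) :
    ¬ Module.Finite K (Derivation C K K) := by
  intro hfin
  obtain ⟨t, ht⟩ := hsurj 1
  have htn (n : ℕ) : t - n ≠ 0 := fun h => by
    have := congr(δ $h)
    simp [ht] at this
  choose y hy using fun n : ℕ => hsurj (t - n)⁻¹
  let ω (n : ℕ) : Module.Dual K (Derivation C K K) :=
    { toFun := fun D => D (y n) - (t - n)⁻¹ * D t
      map_add' := fun D D' => by simp; ring
      map_smul' := fun c D => by simp; ring }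
  have hω (n : ℕ) (D : Derivation C K K) : δ (ω n D) = ω n ⁅δ, D⁆ := by
    have h1 : D (δ (y n)) = _ := congrArg D (hy n)
    simp only [ω, LinearMap.coe_mk, AddHom.coe_mk, Derivation.commutator_apply, h1, ht, map_sub,
      Derivation.leibniz, Derivation.leibniz_inv, Derivation.map_natCast, smul_eq_mul,
      Derivation.map_one_eq_zero]
    ring
  obtain ⟨m, hli, hm⟩ := exists_linearIndependent_and_mem_span (K := K) ω
  obtain ⟨c, hc⟩ := (Submodule.mem_span_range_iff_exists_fun K).1 hm
  have hcω (D : Derivation C K K) : ω m D = ∑ i : Fin m, c i * ω i D := by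
    rw [← hc]; simp
  have hc0 (i : Fin m) : δ (c i) = 0 := by
    refine Fintype.linearIndependent_iff.1 hli (fun i => δ (c i)) (LinearMap.ext fun D => ?_) i
    have := congr(δ $(hcω D))
    simp only [map_sum, Derivation.leibniz, smul_eq_mul, hω, hcω ⁅δ, D⁆,
      Finset.sum_add_distrib] at this
    simpa [mul_comm] using this.symm
  choose d hd using fun i => hconst _ (hc0 i)
  set z := y m - ∑ i : Fin m, algebraMap C K (d i) * y i with hz
  have hzalg : IsAlgebraic (IntermediateField.adjoin C {t}) z := by
    by_contra htrz
    have : CharZero (IntermediateField.adjoin C {t}) :=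
      charZero_of_injective_algebraMap (algebraMap C _).injective
    obtain ⟨D, hD⟩ := exists_derivation_apply_ne_zero htrz
    have hDt : D t = 0 := D.map_algebraMap (IntermediateField.AdjoinSimple.gen C t)
    have := hcω (D.restrictScalars C)
    have hDc (i) : D (algebraMap C K (d i)) = 0 := (D.restrictScalars C).map_algebraMap _
    simp [ω, hDt] at this
    simp [z, this, hd, Derivation.leibniz] at hD
    simp [← hd, hDc] at hD
  obtain ⟨B, A, hB, hAB⟩ : ∃ B A : C[X], B.eval (m : C) ≠ 0 ∧
      (-∑ i : Fin m, algebraMap C K (d i) * (t - (i : ℕ))⁻¹) * aeval t B = aeval t A := by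
    rw [← Finset.sum_neg_distrib]
    refine Finset.sum_induction _ (fun w => ∃ B A : C[X], B.eval (m : C) ≠ 0 ∧
      w * aeval t B = aeval t A) ?_ ⟨1, 0, by simp⟩ ?_
    · rintro w w' ⟨B, A, hB, h⟩ ⟨B', A', hB', h'⟩
      refine ⟨B * B', A * B' + A' * B, by simp [hB, hB'], ?_⟩
      simp only [map_mul, map_add, ← h, ← h']
      ring
    · intro i _
      refine ⟨X - Polynomial.C (i : C), Polynomial.C (-d i), ?_, ?_⟩
      · simpa [sub_eq_zero] using i.2.ne'
      · have := htn i
        simp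
        field_simp
  refine deriv_ne_inv_add δ ht hB hAB hzalg ?_
  simp [z, hy, sub_eq_add_neg]

open MvPolynomial in
theorem IsDiffClosed.isAlgClosed {K : Type*} [Field K] {δ : K → K} (h : IsDiffClosed δ) :
    IsAlgClosed K := by
  refine IsAlgClosed.of_exists_root K fun p _ hp => ?_
  obtain ⟨a, ha, -⟩ := h 0 ((finSuccEquiv K 0).symm (p.map MvPolynomial.C)) 1 (by
    rw [show Fin.last 0 = 0 from rfl, ← natDegree_finSuccEquiv, AlgEquiv.apply_symm_apply,
      natDegree_map]
    exact hp.natDegree_pos) one_ne_zero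
  refine ⟨a, ?_⟩
  have hcons : (fun i : Fin 1 => δ^[(i : ℕ)] a) = Fin.cons a Fin.elim0 := by
    ext i; fin_cases i; rfl
  rw [hcons, eval_eq_eval_mv_eval', AlgEquiv.apply_symm_apply, Polynomial.map_map] at ha
  have : (MvPolynomial.eval (Fin.elim0 : Fin 0 → K)).comp MvPolynomial.C = RingHom.id K := by
    ext; simp
  rwa [this, Polynomial.map_id] at ha

open MvPolynomial in
theorem IsDiffClosed.surjective {K : Type*} [Field K] {δ : K → K} (h : IsDiffClosed δ) :
    Function.Surjective δ := fun g => by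
  obtain ⟨a, ha, -⟩ := h 1 (X 1 - MvPolynomial.C g) 1 (by
    refine lt_of_lt_of_le ?_ (monomial_le_degreeOf _ (m := Finsupp.single 1 1) ?_)
    · simp
    · rw [MvPolynomial.mem_support_iff, MvPolynomial.coeff_sub, MvPolynomial.coeff_X,
        MvPolynomial.coeff_C]
      simp [(Finsupp.single_ne_zero.2 one_ne_zero).symm]) one_ne_zero
  exact ⟨a, by simpa [sub_eq_zero] using ha⟩

theorem IsTranscendenceBasis.infinite_of_isDiffClosed {ι K : Type*} [Field K] [CharZero K]
    {δ : K → K} (hder : IsDerivation δ) (hdc : IsDiffClosed δ) {v : ι → K}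
    (hv : IsTranscendenceBasis ℚ v) : Infinite ι := by
  by_contra hfin
  rw [not_infinite_iff_finite] at hfin
  let D : Derivation ℤ K K := .mk' (AddMonoidHom.mk' δ hder.1).toIntLinearMap fun a b => by
    simp [hder.2, mul_comm, add_comm]
  exact not_finite_derivation D.overConstants (fun x hx => ⟨⟨x, hx⟩, rfl⟩) hdc.surjective
    (finite_derivation_of_isTranscendenceBasis hv)

end

/-- Every differentially closed field of characteristic zero is differentially isomorphic
over `ℚ` to the algebraic closure of a rational function field `ℚ(X_t : t ∈ T)` over an
infinite set `T` of variables, equipped with a suitable derivation. -/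
theorem statement7 {K : Type u} [Field K] [CharZero K] (δ : K → K)
    (hder : IsDerivation δ) (hdc : IsDiffClosed δ) :
    ∃ (T : Type u) (_ : Infinite T)
      (δ' : AlgebraicClosure (FractionRing (MvPolynomial T ℚ)) →
        AlgebraicClosure (FractionRing (MvPolynomial T ℚ)))
      (φ : K ≃+* AlgebraicClosure (FractionRing (MvPolynomial T ℚ))),
      IsDerivation δ' ∧ ∀ a : K, φ (δ a) = δ' (φ a) := by
  have := hdc.isAlgClosed
  obtain ⟨T, v, hv⟩ := exists_isTranscendenceBasis' ℚ K
  have : Algebra.IsAlgebraic (MvPolynomial T ℚ)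
      (AlgebraicClosure (FractionRing (MvPolynomial T ℚ))) :=
    (IsFractionRing.comap_isAlgebraic_iff (K := FractionRing (MvPolynomial T ℚ))).2 inferInstance
  have : FaithfulSMul (MvPolynomial T ℚ)
      (AlgebraicClosure (FractionRing (MvPolynomial T ℚ))) :=
    .trans _ (FractionRing (MvPolynomial T ℚ)) _
  have hX := (IsTranscendenceBasis.mvPolynomial T ℚ).algebraMap_comp
    (A := AlgebraicClosure (FractionRing (MvPolynomial T ℚ)))
  let φ := IsAlgClosed.equivOfTranscendenceBasis v _ (Equiv.refl T) hv hX
  refine ⟨T, hv.infinite_of_isDiffClosed hder hdc, fun x => φ (δ (φ.symm x)), φ, ⟨?_, ?_⟩, ?_⟩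
  · simp [hder.1]
  · simp [hder.2]
  · simp
end

section
/- For every infinite set T there exists a derivation δ on the field 𝔑 defined as the algebraic closure of the rational function field ℚ(X_t : t ∈ T) such that (𝔑, δ) is a differentially closed field. -/
open MvPolynomial in
/-- Over a field `K` formally étale over `ℚ[X_t : t ∈ T]`, the derivatives of the variables
can be prescribed arbitrarily. -/
theorem exists_derivation_X_eq {T K : Type*} [Field K] [Algebra ℚ K]
    [Algebra (MvPolynomial T ℚ) K] [IsScalarTower ℚ (MvPolynomial T ℚ) K]
    [Algebra.FormallyEtale (MvPolynomial T ℚ) K] (f : T → K) :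
    ∃ D : Derivation ℚ K K, ∀ t, D (algebraMap (MvPolynomial T ℚ) K (X t)) = f t := by
  let l := ((mkDerivation ℚ f).liftKaehlerDifferential).liftBaseChange K
  let g := l ∘ₗ
    (KaehlerDifferential.tensorKaehlerEquivOfFormallyEtale ℚ (MvPolynomial T ℚ) K).symm.toLinearMap
  refine ⟨g.compDer (KaehlerDifferential.D ℚ K), fun t => ?_⟩
  have h := KaehlerDifferential.tensorKaehlerEquivOfFormallyEtale_symm_D_algebraMap
    ℚ (MvPolynomial T ℚ) K (X t)
  simp [g, l, h]

open MvPolynomial in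
/-- If the last variable occurs in `p`, then `p(y, z) = 0` is solvable in `z` for all `y` at which
some fixed nonzero polynomial does not vanish. -/
theorem exists_ne_zero_forall_exists_eval_snoc_eq_zero {K : Type*} [Field K] [IsAlgClosed K]
    {n : ℕ} (p : MvPolynomial (Fin (n + 1)) K) (hp : 0 < p.degreeOf (Fin.last n)) :
    ∃ h : MvPolynomial (Fin n) K, h ≠ 0 ∧
      ∀ y : Fin n → K, eval y h ≠ 0 → ∃ z, eval (Fin.snoc y z : Fin (n + 1) → K) p = 0 := by
  set r := rename (finRotate (n + 1)) p with hr
  have hdeg : 0 < (finSuccEquiv K n r).natDegree := by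
    rw [natDegree_finSuccEquiv, ← finRotate_last, hr,
      degreeOf_rename_of_injective (finRotate (n + 1)).injective]
    exact hp
  refine ⟨(finSuccEquiv K n r).leadingCoeff, fun h0 => ?_, fun y hy => ?_⟩
  · rw [Polynomial.leadingCoeff_eq_zero] at h0
    simp [h0] at hdeg
  · obtain ⟨z, hz⟩ := IsAlgClosed.exists_root ((finSuccEquiv K n r).map (eval y)) (by
      rw [Polynomial.degree_map_eq_of_leadingCoeff_ne_zero _ hy]
      exact (Polynomial.natDegree_pos_iff_degree_pos.mp hdeg).ne')
    refine ⟨z, ?_⟩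
    rw [Polynomial.IsRoot, ← eval_eq_eval_mv_eval', hr, eval_rename] at hz
    convert hz using 3
    funext i
    refine Fin.lastCases ?_ (fun j => ?_) i <;> simp

open MvPolynomial in
/-- Any sequence `x` can be shifted by natural numbers in its first `n` entries, and changed at its
`n`-th entry, so as to give a zero of `p` that is not a zero of `q`. -/
theorem exists_natCast_shift_eval_eq_zero {K : Type*} [Field K] [IsAlgClosed K] [CharZero K]
    {n : ℕ} (p : MvPolynomial (Fin (n + 1)) K) (q : MvPolynomial (Fin n) K)
    (hp : 0 < p.degreeOf (Fin.last n)) (hq : q ≠ 0) (x : ℕ → K) :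
    ∃ y : ℕ → K, (∀ i < n, ∃ c : ℕ, y i = x i + c) ∧
      eval (fun i : Fin (n + 1) => y i) p = 0 ∧ eval (fun i : Fin n => y i) q ≠ 0 := by
  obtain ⟨h, h0, hroot⟩ := exists_ne_zero_forall_exists_eval_snoc_eq_zero p hp
  obtain ⟨w, hw, hwq⟩ : ∃ w ∈ Set.pi Set.univ
      (fun i : Fin n => Set.range fun c : ℕ => x i + (c : K)), eval w (h * q) ≠ 0 := by
    by_contra! H
    refine mul_ne_zero h0 hq (funext_set _ (fun i => Set.infinite_range_of_injective ?_)
      (fun w hw => (H w hw).trans (map_zero _).symm))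
    exact fun a b hab => by simpa using hab
  rw [map_mul] at hwq
  obtain ⟨z, hz⟩ := hroot w (left_ne_zero_of_mul hwq)
  refine ⟨fun i => if hi : i < n then w ⟨i, hi⟩ else z, fun i hi => ?_, ?_, ?_⟩
  · obtain ⟨c, hc⟩ := hw ⟨i, hi⟩ (Set.mem_univ _)
    exact ⟨c, by simp [hi, ← hc]⟩
  · convert hz using 3
    funext i
    refine Fin.lastCases ?_ (fun j => ?_) i <;> simp
  · simpa using right_ne_zero_of_mul hwq

open MvPolynomial Cardinal in
/-- An infinite type bounding the size of a field `K` has room for a sequence for each pair of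
polynomials appearing in Blum's axioms. -/
theorem nonempty_blum_pairs_embedding.{u} {K T : Type u} [Field K] [Infinite T] (hK : #K ≤ #T) :
    Nonempty ((Σ n : ℕ, MvPolynomial (Fin (n + 1)) K × MvPolynomial (Fin n) K) × ℕ ↪ T) := by
  have hT := aleph0_le_mk T
  have hpoly (n : ℕ) : #(MvPolynomial (Fin n) K) ≤ #T :=
    cardinalMk_le_max_lift.trans (by simp [hK, hT, (natCast_lt_aleph0.trans_le hT).le])
  have hpair (n : ℕ) : #(MvPolynomial (Fin (n + 1)) K × MvPolynomial (Fin n) K) ≤ #T := by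
    rw [mk_prod, lift_id, lift_id]
    exact (mul_le_mul' (hpoly _) (hpoly _)).trans (mul_eq_self hT).le
  have hsum : #(Σ n : ℕ, MvPolynomial (Fin (n + 1)) K × MvPolynomial (Fin n) K) ≤ #T := by
    rw [mk_sigma]
    refine (sum_le_sum _ (fun _ => #T) hpair).trans ?_
    simp [hT]
  rw [← Cardinal.le_def, mk_prod, lift_uzero, mk_nat, lift_aleph0]
  exact (mul_le_mul' hsum hT).trans (mul_eq_self hT).le

/-- For every infinite set `T` there is a derivation `δ` on the algebraic closure `𝔑` of the
rational function field `ℚ(X_t : t ∈ T)` such that `(𝔑, δ)` is differentially closed. -/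
theorem statement10 {T : Type*} [Infinite T] :
    ∃ δ : AlgebraicClosure (FractionRing (MvPolynomial T ℚ)) →
        AlgebraicClosure (FractionRing (MvPolynomial T ℚ)),
      IsDerivation δ ∧ IsDiffClosed δ := by
  let S := MvPolynomial T ℚ
  let F := FractionRing S
  let K := AlgebraicClosure F
  have : Algebra.FormallyEtale S F := .of_isLocalization (nonZeroDivisors S)
  have : Algebra.FormallyEtale F K := .of_isSeparable F K
  have : Algebra.FormallyEtale S K := .comp S F K
  have hK : Cardinal.mk K ≤ Cardinal.mk T := by
    have hT := Cardinal.aleph0_le_mk T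
    have hF : Cardinal.mk F ≤ Cardinal.mk T := by
      refine (IsFractionRing.cardinalMk S F).le.trans ?_
      refine MvPolynomial.cardinalMk_le_max_lift.trans ?_
      simp [hT]
    exact (Algebra.IsAlgebraic.cardinalMk_le_max F K).trans (max_le hF hT)
  obtain ⟨e⟩ := nonempty_blum_pairs_embedding (K := K) (T := T) hK
  let x : T → K := fun t => algebraMap S K (MvPolynomial.X t)
  choose y hyx hyp hyq using fun (n : ℕ) (p : MvPolynomial (Fin (n + 1)) K)
    (q : MvPolynomial (Fin n) K) (h : 0 < p.degreeOf (Fin.last n) ∧ q ≠ 0) =>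
      exists_natCast_shift_eval_eq_zero p q h.1 h.2 fun i => x (e (⟨n, p, q⟩, i))
  classical
  obtain ⟨D, hD⟩ := exists_derivation_X_eq (K := K) (Function.extend e (fun s =>
    if h : 0 < s.1.2.1.degreeOf (Fin.last s.1.1) ∧ s.1.2.2 ≠ 0 then
      y s.1.1 s.1.2.1 s.1.2.2 h (s.2 + 1) else 0) 0)
  refine ⟨D, ⟨fun a b => map_add D a b, fun a b => ?_⟩, fun n p q hp hq => ?_⟩
  · rw [D.leibniz, smul_eq_mul, smul_eq_mul]
    ring
  · have hiter : ∀ i ≤ n, D^[i] (y n p q ⟨hp, hq⟩ 0) = y n p q ⟨hp, hq⟩ i := by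
      intro i hi
      induction i with
      | zero => rfl
      | succ i ih =>
        obtain ⟨c, hc⟩ := hyx n p q ⟨hp, hq⟩ i hi
        rw [Function.iterate_succ_apply', ih (Nat.le_of_succ_le hi), hc, map_add,
          D.map_natCast, add_zero, hD, e.injective.extend_apply, dif_pos ⟨hp, hq⟩]
    refine ⟨y n p q ⟨hp, hq⟩ 0, ?_, ?_⟩
    · rw [funext fun i : Fin (n + 1) => hiter i (Nat.le_of_lt_succ i.2)]
      exact hyp n p q ⟨hp, hq⟩
    · rw [funext fun i : Fin n => hiter i i.2.le]
      exact hyq n p q ⟨hp, hq⟩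
end

section
/- Let T be an infinite set and let 𝔑 be the algebraic closure of the rational function field ℚ(X_t : t ∈ T). Then the set of all derivations δ on 𝔑 such that (𝔑, δ) is a differentially closed field has cardinality at least 2^{card(T)}. -/
/-- A derivation extends along a formally étale algebra. -/
theorem Derivation.exists_extend_of_formallyEtale {k A K : Type*} [CommRing k] [CommRing A]
    [CommRing K] [Algebra k A] [Algebra k K] [Algebra A K] [IsScalarTower k A K]
    [Algebra.FormallyEtale A K] (d : Derivation k A K) :
    ∃ D : Derivation k K K, ∀ a, D (algebraMap A K a) = d a := by
  have h := KaehlerDifferential.isBaseChange_of_formallyEtale k A K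
  refine ⟨(h.lift d.liftKaehlerDifferential).compDer (KaehlerDifferential.D k K), fun a => ?_⟩
  have := h.lift_eq d.liftKaehlerDifferential (KaehlerDifferential.D k A a)
  simpa using this

/-- In characteristic zero, a derivation may be prescribed arbitrarily on a transcendence basis. -/
theorem IsTranscendenceBasis.exists_derivation {T F K : Type*} [Field F] [CharZero F] [Field K]
    [Algebra F K] {x : T → K} (hx : IsTranscendenceBasis F x) (f : T → K) :
    ∃ D : Derivation F K K, ∀ t, D (x t) = f t := by
  let A := MvPolynomial T F
  let L := FractionRing A
  let : Algebra A K := (MvPolynomial.aeval x).toAlgebra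
  have : FaithfulSMul A K := (faithfulSMul_iff_algebraMap_injective A K).2 hx.1
  have : IsScalarTower F A K := .of_algebraMap_eq fun r => by
    rw [RingHom.algebraMap_toAlgebra]; simp [A]
  let : Algebra L K := FractionRing.liftAlgebra A K
  have : IsScalarTower A L K := FractionRing.isScalarTower_liftAlgebra A K
  have : CharZero L := charZero_of_injective_algebraMap (algebraMap F L).injective
  have : Algebra.IsAlgebraic A K := by
    have := hx.isAlgebraic
    refine ⟨fun a => (this.isAlgebraic a).of_ringHom_of_comp_eq
      hx.1.aevalEquiv.toRingHom (RingHom.id K) hx.1.aevalEquiv.surjective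
      Function.injective_id ?_⟩
    ext <;> simp [RingHom.algebraMap_toAlgebra]
  have : Algebra.IsAlgebraic L K :=
    (IsFractionRing.comap_isAlgebraic_iff (A := A) (K := L) (C := K)).1 inferInstance
  have : Algebra.FormallyEtale A L := .of_isLocalization (nonZeroDivisors A)
  have : Algebra.FormallyEtale L K := .of_isSeparable L K
  have : Algebra.FormallyEtale A K := .comp A L K
  obtain ⟨D, hD⟩ := Derivation.exists_extend_of_formallyEtale
    (MvPolynomial.mkDerivation F f : Derivation F A K)
  refine ⟨D, fun t => ?_⟩
  have := hD (MvPolynomial.X t)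
  rw [RingHom.algebraMap_toAlgebra] at this
  simpa using this

/-- A nonzero polynomial over `K` does not vanish at distinct elements of a transcendence basis
lying outside some finite set depending on the polynomial. -/
theorem IsTranscendenceBasis.exists_finite_eval_ne_zero {T ι F K : Type*} [Field F] [Field K]
    [Algebra F K] {x : T → K} (hx : IsTranscendenceBasis F x) {r : MvPolynomial ι K}
    (hr : r ≠ 0) :
    ∃ S : Set T, S.Finite ∧ ∀ g : ι → T, Function.Injective g → (∀ i, g i ∉ S) →
      MvPolynomial.eval (fun i => x (g i)) r ≠ 0 := by
  have hcl : (r.coeffs : Set K) ⊆ (AlgebraicIndependent.matroid F K).closure (Set.range x) := by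
    rw [AlgebraicIndependent.matroid_closure_eq]
    have := hx.isAlgebraic
    exact fun a _ => this.isAlgebraic a
  obtain ⟨I, hIx, hI, -, hrI⟩ := Matroid.exists_subset_finite_closure_of_subset_closure
    (r.coeffs.finite_toSet) hcl
  refine ⟨x ⁻¹' I, hI.preimage hx.1.injective.injOn, fun g hg hgI h0 => hr ?_⟩
  rw [AlgebraicIndependent.matroid_closure_eq] at hrI
  have hind : AlgebraicIndependent (Algebra.adjoin F I) fun i => x (g i) := by
    rw [← Set.image_preimage_eq_of_subset hIx]
    exact ((AlgebraicIndependent.iff_adjoin_image (x ⁻¹' I)).1 hx.1).2.comp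
      (fun i => ⟨g i, hgI i⟩) fun i j hij => hg (congrArg Subtype.val hij)
  obtain ⟨r', rfl⟩ := (MvPolynomial.mem_range_map_iff_coeffs_subset
    (f := algebraMap (Subalgebra.algebraicClosure (Algebra.adjoin F I) K) K)).2
      (by simpa using hrI)
  rw [MvPolynomial.eval_map, ← MvPolynomial.aeval_def] at h0
  rw [hind.subalgebraAlgebraicClosure.eq_zero_of_aeval_eq_zero _ h0, map_zero]

/-- Over an algebraically closed field one can solve for the last variable when the leading
coefficient in that variable does not vanish. -/
theorem MvPolynomial.exists_eval_snoc_eq_zero {K : Type*} [Field K] [IsAlgClosed K] {n : ℕ}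
    {p : MvPolynomial (Fin (n + 1)) K} (hp : 0 < p.degreeOf (Fin.last n)) {s : Fin n → K}
    (hs : eval s (optionEquivLeft K (Fin n) (rename finSuccEquivLast p)).leadingCoeff ≠ 0) :
    ∃ b : K, eval (Fin.snoc s b : Fin (n + 1) → K) p = 0 := by
  set P := optionEquivLeft K (Fin n) (rename finSuccEquivLast p) with hP
  have hdeg : P.natDegree = p.degreeOf (Fin.last n) := by
    rw [hP, natDegree_optionEquivLeft, ← finSuccEquivLast_last,
      degreeOf_rename_of_injective (Equiv.injective _)]
  have hdeg' : (P.map (eval s)).degree ≠ 0 := by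
    have := Polynomial.natDegree_map_of_leadingCoeff_ne_zero _ hs
    intro h
    have := Polynomial.natDegree_eq_of_degree_eq_some (n := 0) h
    omega
  obtain ⟨b, hb⟩ := IsAlgClosed.exists_root _ hdeg'
  refine ⟨b, ?_⟩
  rw [Polynomial.IsRoot, ← optionEquivLeft_elim_eval, eval_rename] at hb
  convert hb using 3
  funext i
  refine Fin.lastCases ?_ (fun i => ?_) i <;> simp

/-- Given a sequence of distinct elements of a transcendence basis, every differential-closedness
condition is witnessed by a block of consecutive terms of the sequence followed by some element
of `K`. -/
theorem IsTranscendenceBasis.exists_block_witness {T F K : Type*} [Field F] [Field K]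
    [Algebra F K] [IsAlgClosed K] {x : T → K} (hx : IsTranscendenceBasis F x) {n : ℕ}
    {p : MvPolynomial (Fin (n + 1)) K} {q : MvPolynomial (Fin n) K}
    (hp : 0 < p.degreeOf (Fin.last n)) (hq : q ≠ 0) {g : ℕ → T} (hg : Function.Injective g) :
    ∃ (N : ℕ) (b : K),
      MvPolynomial.eval (Fin.snoc (fun i : Fin n => x (g (N + i))) b : Fin (n + 1) → K) p = 0 ∧
      MvPolynomial.eval (fun i : Fin n => x (g (N + i))) q ≠ 0 := by
  set l := (MvPolynomial.optionEquivLeft K (Fin n)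
    (MvPolynomial.rename finSuccEquivLast p)).leadingCoeff with hl
  have hl0 : l ≠ 0 := by
    rw [hl, Polynomial.leadingCoeff_ne_zero]
    intro h
    rw [map_eq_zero_iff _ (AlgEquiv.injective _),
      map_eq_zero_iff _ (MvPolynomial.rename_injective _ (Equiv.injective _))] at h
    simp [h] at hp
  obtain ⟨S, hS, h⟩ := hx.exists_finite_eval_ne_zero (mul_ne_zero hq hl0)
  obtain ⟨M, hM⟩ := (hS.preimage hg.injOn).bddAbove
  have := h (fun i : Fin n => g (M + 1 + i)) (fun i j hij => Fin.ext (by simpa using hg hij))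
    (fun i hi => by have := hM (show M + 1 + (i : ℕ) ∈ g ⁻¹' S from hi); omega)
  rw [map_mul, mul_ne_zero_iff] at this
  obtain ⟨b, hb⟩ := MvPolynomial.exists_eval_snoc_eq_zero hp this.2
  exact ⟨M + 1, b, hb, this.1⟩

theorem IsDerivation.of_derivation {R K : Type*} [CommRing R] [Field K] [Algebra R K]
    (D : Derivation R K K) : IsDerivation D :=
  ⟨map_add D, fun a b => by simp [mul_comm, add_comm]⟩

/-- The data of a differential-closedness condition over `K`: an order together with the
polynomial equation and inequation. -/
abbrev DiffCondition (K : Type*) [Field K] :=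
  Σ n : ℕ, MvPolynomial (Fin (n + 1)) K × MvPolynomial (Fin n) K

theorem DiffCondition.cardinalMk_le (K : Type u) [Field K] [Infinite K] :
    Cardinal.mk (DiffCondition K) ≤ Cardinal.mk K := by
  have hK := Cardinal.aleph0_le_mk K
  have key (n : ℕ) : Cardinal.mk (MvPolynomial (Fin n) K) ≤ Cardinal.mk K :=
    MvPolynomial.cardinalMk_le_max_lift.trans (by
      simp [Cardinal.natCast_lt_aleph0.le.trans hK, hK])
  rw [Cardinal.mk_sigma]
  refine (Cardinal.sum_le_sum _ (fun _ => Cardinal.mk K) fun n => ?_).trans ?_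
  · rw [Cardinal.mk_prod, Cardinal.lift_id, Cardinal.lift_id]
    exact (mul_le_mul' (key _) (key _)).trans (Cardinal.mul_eq_self hK).le
  · simp [hK]

/-- If `T` is partitioned into a sequence for each differential-closedness condition and a
remaining part `T'`, then each choice of values on the remaining part of the transcendence basis
extends to a differentially closed derivation. -/
theorem IsTranscendenceBasis.exists_isDiffClosed {T T' F K : Type*} [Field F] [CharZero F]
    [Field K] [Algebra F K] [IsAlgClosed K] {x : T → K} (hx : IsTranscendenceBasis F x)
    (e : (DiffCondition K × ℕ) ⊕ T' ≃ T) (c : T' → K) :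
    ∃ D : Derivation F K K, IsDiffClosed D ∧ ∀ t, D (x (e (.inr t))) = c t := by
  have hw (τ : DiffCondition K) : ∃ (N : ℕ) (b : K),
      0 < τ.2.1.degreeOf (Fin.last τ.1) → τ.2.2 ≠ 0 →
      MvPolynomial.eval
        (Fin.snoc (fun i : Fin τ.1 => x (e (.inl (τ, N + i)))) b : Fin (τ.1 + 1) → K) τ.2.1 = 0 ∧
      MvPolynomial.eval (fun i : Fin τ.1 => x (e (.inl (τ, N + i)))) τ.2.2 ≠ 0 := by
    by_cases h : 0 < τ.2.1.degreeOf (Fin.last τ.1) ∧ τ.2.2 ≠ 0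
    · obtain ⟨N, b, h⟩ := hx.exists_block_witness h.1 h.2 (g := fun j => e (.inl (τ, j)))
        (fun i j hij => by simpa using hij)
      exact ⟨N, b, fun _ _ => h⟩
    · exact ⟨0, 0, fun h1 h2 => (h ⟨h1, h2⟩).elim⟩
  choose N b hNb using hw
  obtain ⟨D, hD⟩ := hx.exists_derivation fun t =>
    Sum.elim (fun τj : DiffCondition K × ℕ =>
      if τj.2 + 1 < N τj.1 + τj.1.1 then x (e (.inl (τj.1, τj.2 + 1))) else b τj.1) c (e.symm t)
  refine ⟨D, fun n p q hp hq => ?_, fun t => by simp [hD]⟩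
  let τ : DiffCondition K := ⟨n, p, q⟩
  let z (i : ℕ) : K := if i < n then x (e (.inl (τ, N τ + i))) else b τ
  have hz (i : ℕ) (hi : i < n) : D (z i) = z (i + 1) := by
    simp only [z, hi, if_true, hD, Equiv.symm_apply_apply, Sum.elim_inl, add_assoc,
      add_lt_add_iff_left]
    rfl
  have hiter (i : ℕ) (hi : i ≤ n) : D^[i] (z 0) = z i := by
    induction i with
    | zero => rfl
    | succ i ih => rw [Function.iterate_succ_apply', ih (by omega), hz i (by omega)]
  obtain ⟨h1, h2⟩ := hNb τ hp hq
  refine ⟨z 0, ?_, ?_⟩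
  · convert h1 using 3
    funext i
    rw [hiter i (by omega)]
    refine Fin.lastCases ?_ (fun i => ?_) i <;> simp [z, τ]
  · convert h2 using 4 with i
    rw [hiter i (by omega)]
    simp [z, τ]

theorem IsTranscendenceBasis.two_power_le_mk_isDiffClosed {T K : Type u} [Infinite T] [Field K]
    {F : Type*} [Field F] [CharZero F] [Algebra F K] [IsAlgClosed K] {x : T → K}
    (hx : IsTranscendenceBasis F x) (hTK : Cardinal.mk K ≤ Cardinal.mk T) :
    2 ^ Cardinal.mk T ≤ Cardinal.mk {δ : K → K // IsDerivation δ ∧ IsDiffClosed δ} := by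
  have hT := Cardinal.aleph0_le_mk T
  have hcard : Cardinal.mk ((DiffCondition K × ℕ) ⊕ T) = Cardinal.mk T := by
    have : Infinite K := IsAlgClosed.instInfinite
    have h : Cardinal.mk (DiffCondition K × ℕ) ≤ Cardinal.mk T := by
      rw [Cardinal.mk_prod]
      simpa using (mul_le_mul' ((DiffCondition.cardinalMk_le K).trans hTK) hT).trans
        (Cardinal.mul_eq_self hT).le
    rw [Cardinal.mk_sum, Cardinal.lift_id, Cardinal.lift_id, Cardinal.add_eq_right hT h]
  obtain ⟨e⟩ := Cardinal.eq.1 hcard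
  choose D hD hDc using fun s : Set T =>
    hx.exists_isDiffClosed e (s.indicator (fun _ => (1 : K)))
  rw [← Cardinal.mk_set]
  refine Cardinal.mk_le_of_injective
    (f := fun s => ⟨D s, IsDerivation.of_derivation (D s), hD s⟩) fun s s' h => ?_
  have hfun : (D s : K → K) = D s' := congrArg Subtype.val h
  refine Set.indicator_one_inj K ?_
  funext t
  exact (hDc s t).symm.trans ((congrFun hfun _).trans (hDc s' t))

/-- For an infinite set `T`, the set of derivations `δ` on the algebraic closure `𝔑` of
`ℚ(X_t : t ∈ T)` making `(𝔑, δ)` differentially closed has cardinality at least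
`2 ^ card T`. -/
theorem statement11 {T : Type u} [Infinite T] :
    2 ^ Cardinal.mk T ≤
      Cardinal.mk {δ : AlgebraicClosure (FractionRing (MvPolynomial T ℚ)) →
          AlgebraicClosure (FractionRing (MvPolynomial T ℚ)) //
        IsDerivation δ ∧ IsDiffClosed δ} := by
  have : Algebra.IsAlgebraic (MvPolynomial T ℚ) (FractionRing (MvPolynomial T ℚ)) :=
    IsLocalization.isAlgebraic _ (nonZeroDivisors (MvPolynomial T ℚ))
  have hx := ((IsTranscendenceBasis.mvPolynomial T ℚ).algebraMap_comp
    (A := FractionRing (MvPolynomial T ℚ))).algebraMap_comp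
      (A := AlgebraicClosure (FractionRing (MvPolynomial T ℚ)))
  refine hx.two_power_le_mk_isDiffClosed ?_
  refine (Algebra.IsAlgebraic.cardinalMk_le_max (FractionRing (MvPolynomial T ℚ)) _).trans ?_
  rw [FractionRing.cardinalMk]
  simp
end

section
/- Let T₁ be a nonempty set, let K be the algebraic closure of the rational function field ℚ(X_t : t ∈ T₁), and let δ be a derivation on K. Then there exist a field L with a derivation δ* and an injective ring homomorphism ι : K → L with ι ∘ δ = δ* ∘ ι such that: (1) (L, δ*) is a differentially closed field; (2) the cardinality of L equals max(card(T₁), ℵ₀); and (3) (L, δ*) is a universal extension of (K, δ): for every differential field (F, δ₀) together with an injective ring homomorphism j : K → F satisfying j ∘ δ = δ₀ ∘ j, such that F is a finitely generated field extension of j(K), there exists an injective ring homomorphism ψ : F → L with ψ ∘ j = ι and ψ ∘ δ₀ = δ* ∘ ψ. -/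
/-- The data of a differentially closed universal extension `(L, δ*)` of the differential
field `(K, δ)`, where `K` is the algebraic closure of `ℚ(X_t : t ∈ T₁)`:
`ι : K → L` is an injective ring homomorphism commuting with the derivations, `(L, δ*)` is
differentially closed, `card L = max (card T₁) ℵ₀`, and every finitely generated
differential field extension of (an isomorphic copy of) `K` embeds differentially into `L`
compatibly with `ι`. -/
structure UniversalDCFExtension (T₁ : Type u)
    (δ : AlgebraicClosure (FractionRing (MvPolynomial T₁ ℚ)) →
      AlgebraicClosure (FractionRing (MvPolynomial T₁ ℚ))) : Type (u + 1) where
  L : Type u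
  [instL : Field L]
  δs : L → L
  ι : AlgebraicClosure (FractionRing (MvPolynomial T₁ ℚ)) →+* L
  ι_inj : Function.Injective ι
  ι_comm : ∀ a, ι (δ a) = δs (ι a)
  δs_der : IsDerivation δs
  δs_dcf : IsDiffClosed δs
  card_eq : Cardinal.mk L = max (Cardinal.mk T₁) Cardinal.aleph0
  universal : ∀ (F : Type u) [Field F] (δ₀ : F → F)
      (j : AlgebraicClosure (FractionRing (MvPolynomial T₁ ℚ)) →+* F),
      IsDerivation δ₀ → Function.Injective j →
      (∀ a, j (δ a) = δ₀ (j a)) →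
      (∃ s : Finset F, Subfield.closure (Set.range j ∪ ↑s) = ⊤) →
      ∃ ψ : F →+* L, Function.Injective ψ ∧ (∀ a, ψ (j a) = ι a) ∧
        ∀ x, ψ (δ₀ x) = δs (ψ x)

theorem isAlgebraic_aeval_toAlgebra {ι R A : Type*} [CommRing R] [Nontrivial R] [CommRing A]
    [IsDomain A] [Algebra R A] {x : ι → A} (hx : IsTranscendenceBasis R x) :
    @Algebra.IsAlgebraic (MvPolynomial ι R) A _ _ (MvPolynomial.aeval x).toAlgebra := by
  let : Algebra (MvPolynomial ι R) A := (MvPolynomial.aeval x).toAlgebra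
  have := hx.isAlgebraic
  let e := hx.1.aevalEquiv
  let : Algebra (MvPolynomial ι R) (Algebra.adjoin R (Set.range x)) := e.toRingHom.toAlgebra
  have : IsScalarTower (MvPolynomial ι R) (Algebra.adjoin R (Set.range x)) A :=
    .of_algebraMap_eq fun p ↦ (hx.1.algebraMap_aevalEquiv p).symm
  have : Algebra.IsAlgebraic (MvPolynomial ι R) (Algebra.adjoin R (Set.range x)) :=
    ⟨fun y ↦ by
      obtain ⟨p, rfl⟩ := e.surjective y
      exact isAlgebraic_algebraMap p⟩
  have : NoZeroDivisors (Algebra.adjoin R (Set.range x)) := inferInstance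
  have : IsDomain R := hx.1.algebraMap_injective.isDomain _
  exact .trans (MvPolynomial ι R) (Algebra.adjoin R (Set.range x)) A

open Algebra KaehlerDifferential in
theorem exists_derivation_of_isTranscendenceBasis {ι k F : Type*} [Field k] [Field F] [CharZero F]
    [Algebra k F] {x : ι → F} (hx : IsTranscendenceBasis k x) (g : ι → F) :
    ∃ D : Derivation k F F, ∀ i, D (x i) = g i := by
  let P := MvPolynomial ι k
  have : CharZero k := (algebraMap k F).charZero_iff (algebraMap k F).injective |>.2 ‹_›
  let : Algebra P F := (MvPolynomial.aeval x).toAlgebra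
  have : IsScalarTower k P F := .of_algebraMap_eq' (MvPolynomial.aeval x).comp_algebraMap.symm
  have : FaithfulSMul P F := (faithfulSMul_iff_algebraMap_injective P F).2 hx.1
  let := FractionRing.liftAlgebra P F
  have := FractionRing.isScalarTower_liftAlgebra P F
  have : Algebra.IsAlgebraic P F := isAlgebraic_aeval_toAlgebra hx
  have : Algebra.IsAlgebraic (FractionRing P) F :=
    ⟨fun y ↦ (IsFractionRing.isAlgebraic_iff P (FractionRing P) F).1 (IsAlgebraic.isAlgebraic y)⟩
  have : CharZero (FractionRing P) :=
    charZero_of_injective_algebraMap (algebraMap k (FractionRing P)).injective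
  have : FormallyEtale (FractionRing P) F := .of_isSeparable _ _
  have : FormallyEtale P (FractionRing P) := .of_isLocalization (nonZeroDivisors P)
  have : FormallyEtale P F := .comp P (FractionRing P) F
  let d : Derivation k P F := MvPolynomial.mkDerivation k g
  let l : Ω[F⁄k] →ₗ[F] F := (d.liftKaehlerDifferential.liftBaseChange F) ∘ₗ
    (tensorKaehlerEquivOfFormallyEtale k P F).symm.toLinearMap
  refine ⟨l.compDer (D k F), fun i ↦ ?_⟩
  have hi : x i = algebraMap P F (MvPolynomial.X i) := (MvPolynomial.aeval_X x i).symm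
  simp only [hi]
  simp [l, tensorKaehlerEquivOfFormallyEtale_symm_D_algebraMap, d, P,
    MvPolynomial.mkDerivation_X]

theorem exists_algHom_apply_eq {ι K A B : Type*} [Field K] [Field A] [Field B] [Algebra K A]
    [Algebra K B] [IsAlgClosed B] {x : ι → A} (hx : IsTranscendenceBasis K x) {y : ι → B}
    (hy : AlgebraicIndependent K y) : ∃ f : A →ₐ[K] B, ∀ i, f (x i) = y i := by
  let P := MvPolynomial ι K
  let : Algebra P A := (MvPolynomial.aeval x).toAlgebra
  have : IsScalarTower K P A := .of_algebraMap_eq' (MvPolynomial.aeval x).comp_algebraMap.symm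
  have : FaithfulSMul P A := (faithfulSMul_iff_algebraMap_injective P A).2 hx.1
  let : Algebra P B := (MvPolynomial.aeval y).toAlgebra
  have : IsScalarTower K P B := .of_algebraMap_eq' (MvPolynomial.aeval y).comp_algebraMap.symm
  have : FaithfulSMul P B := (faithfulSMul_iff_algebraMap_injective P B).2 hy
  have : Algebra.IsAlgebraic P A := isAlgebraic_aeval_toAlgebra hx
  let f : A →ₐ[P] B := IsAlgClosed.lift
  refine ⟨f.restrictScalars K, fun i ↦ ?_⟩
  have hi : x i = algebraMap P A (MvPolynomial.X i) := (MvPolynomial.aeval_X x i).symm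
  have hi' : y i = algebraMap P B (MvPolynomial.X i) := (MvPolynomial.aeval_X y i).symm
  simp only [hi, hi']
  exact f.commutes _

theorem exists_finset_isAlgebraic_adjoin {ι K F : Type*} [Field K] [Field F] [Algebra K F]
    {x : ι → F} (hx : IsTranscendenceBasis K x) (c : F) :
    ∃ s : Finset ι, IsAlgebraic (Algebra.adjoin K (x '' s)) c := by
  have hc : c ∈ (AlgebraicIndependent.matroid K F).closure (Set.range x) := by
    rw [AlgebraicIndependent.matroid_closure_eq]
    exact hx.isAlgebraic.isAlgebraic c
  obtain ⟨t, ht, htf, -, hct⟩ := Matroid.exists_mem_finite_closure_of_mem_closure hc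
  classical
  lift t to Finset F using htf
  rw [← Set.image_univ, Finset.subset_set_image_iff] at ht
  obtain ⟨s, -, rfl⟩ := ht
  rw [AlgebraicIndependent.matroid_closure_eq, Finset.coe_image] at hct
  exact ⟨s, hct⟩

theorem IsDerivation.map_zero {K : Type*} [Field K] {δ : K → K} (h : IsDerivation δ) :
    δ 0 = 0 := by
  simpa using h.1 0 0

theorem IsDerivation.map_one {K : Type*} [Field K] {δ : K → K} (h : IsDerivation δ) :
    δ 1 = 0 := by
  simpa using h.2 1 1

theorem IsDerivation.map_neg {K : Type*} [Field K] {δ : K → K} (h : IsDerivation δ) (a : K) :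
    δ (-a) = -δ a :=
  eq_neg_of_add_eq_zero_left (by rw [← h.1, neg_add_cancel, h.map_zero])

theorem IsDerivation.map_inv {K : Type*} [Field K] {δ : K → K} (h : IsDerivation δ) (a : K) :
    δ a⁻¹ = -a⁻¹ ^ 2 * δ a := by
  rcases eq_or_ne a 0 with rfl | ha
  · simp [h.map_zero]
  · have := h.2 a a⁻¹
    rw [mul_inv_cancel₀ ha, h.map_one] at this
    linear_combination -a⁻¹ * this - δ a⁻¹ * inv_mul_cancel₀ ha

/-- The subfield on which a field homomorphism intertwines two derivations. -/
def derivationEqualizer {F L : Type*} [Field F] [Field L] {δ : F → F} {D : L → L}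
    (hδ : IsDerivation δ) (hD : IsDerivation D) (σ : F →+* L) : Subfield F where
  carrier := {a | σ (δ a) = D (σ a)}
  zero_mem' := by simp [hδ.map_zero, hD.map_zero]
  one_mem' := by simp [hδ.map_one, hD.map_one]
  add_mem' {a b} ha hb := by
    simp only [Set.mem_ofPred_eq] at *
    rw [hδ.1, map_add, map_add, hD.1, ha, hb]
  mul_mem' {a b} ha hb := by
    simp only [Set.mem_ofPred_eq] at *
    rw [hδ.2, map_add, map_mul, map_mul, map_mul, hD.2, ha, hb]
  neg_mem' {a} ha := by
    simp only [Set.mem_ofPred_eq] at *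
    rw [hδ.map_neg, RingHom.map_neg, RingHom.map_neg, hD.map_neg, ha]
  inv_mem' a ha := by
    simp only [Set.mem_ofPred_eq] at *
    rw [hδ.map_inv, map_inv₀, hD.map_inv, map_mul, ha]
    simp

theorem mem_derivationEqualizer_of_isAlgebraic {F L : Type*} [Field F] [CharZero F] [Field L]
    {δ : F → F} {D : L → L} (hδ : IsDerivation δ) (hD : IsDerivation D) (σ : F →+* L) {x : F}
    (hx : IsAlgebraic (derivationEqualizer hδ hD σ) x) : x ∈ derivationEqualizer hδ hD σ := by
  set E := derivationEqualizer hδ hD σ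
  let : Algebra F L := σ.toAlgebra
  have hE (a : E) : σ (δ a) = D (σ a) := a.2
  let d : Derivation E F L := Derivation.mk'
    { toFun a := σ (δ a) - D (σ a)
      map_add' a b := by
        rw [hδ.1, map_add, map_add, hD.1]
        ring
      map_smul' a b := by
        change σ (δ (a * b)) - D (σ (a * b)) = σ a * (σ (δ b) - D (σ b))
        rw [hδ.2, map_add, map_mul, map_mul, map_mul, hD.2, hE]
        ring } fun a b ↦ by
      change σ (δ (a * b)) - D (σ (a * b)) = σ a * (σ (δ b) - D (σ b)) + σ b * (σ (δ a) - D (σ a))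
      rw [hδ.2, map_add, map_mul, map_mul, map_mul, hD.2]
      ring
  have h := d.map_aeval (minpoly E x) x
  rw [minpoly.aeval, _root_.map_zero, eq_comm] at h
  have hne : Polynomial.aeval x (Polynomial.derivative (minpoly E x)) ≠ 0 :=
    (minpoly.irreducible hx.isIntegral).separable.aeval_derivative_ne_zero (minpoly.aeval E x)
  exact sub_eq_zero.1 ((smul_eq_zero.1 h).resolve_left hne)

theorem comm_of_isTranscendenceBasis {ι k F L : Type*} [Field k] [Field F] [CharZero F]
    [Field L] [Algebra k F] {δ : F → F} {D : L → L} (hδ : IsDerivation δ) (hD : IsDerivation D)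
    (σ : F →+* L) {x : ι → F} (hx : IsTranscendenceBasis k x)
    (hk : ∀ a : k, σ (δ (algebraMap k F a)) = D (σ (algebraMap k F a)))
    (hσ : ∀ i, σ (δ (x i)) = D (σ (x i))) (a : F) : σ (δ a) = D (σ a) := by
  set E := derivationEqualizer hδ hD σ
  let : Algebra k E := ((algebraMap k F).codRestrict E hk).toAlgebra
  have : IsScalarTower k E F := .of_algebraMap_eq fun _ ↦ rfl
  have := hx.isAlgebraic
  have hle : ∀ b ∈ Algebra.adjoin k (Set.range x), b ∈ E := by
    intro b hb
    induction hb using Algebra.adjoin_induction with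
    | mem b hb => obtain ⟨i, rfl⟩ := hb; exact hσ i
    | algebraMap r => exact hk r
    | add a b _ _ ha hb => exact add_mem ha hb
    | mul a b _ _ ha hb => exact mul_mem ha hb
  let : Algebra (Algebra.adjoin k (Set.range x)) E :=
    (Subring.inclusion (S := (Algebra.adjoin k (Set.range x)).toSubring) (T := E.toSubring)
      hle).toAlgebra
  have : IsScalarTower (Algebra.adjoin k (Set.range x)) E F := .of_algebraMap_eq fun _ ↦ rfl
  refine mem_derivationEqualizer_of_isAlgebraic hδ hD σ ?_
  refine (Algebra.IsAlgebraic.isAlgebraic (R := Algebra.adjoin k (Set.range x)) a).extendScalars ?_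
  exact fun a b h ↦ Subtype.ext congr(($h : F))

theorem MvPolynomial.eval_ne_zero_of_algebraicIndependent {σ L : Type*} [Field L]
    (M : Subring L) {v : σ → L} (hv : AlgebraicIndependent M v) {q : MvPolynomial σ L}
    (hq : ∀ m, q.coeff m ∈ M) (hq0 : q ≠ 0) : MvPolynomial.eval v q ≠ 0 := by
  have : q ∈ Set.range (MvPolynomial.map (algebraMap M L)) := by
    rw [MvPolynomial.mem_range_map_iff_coeffs_subset]
    intro c hc
    obtain ⟨m, -, rfl⟩ := MvPolynomial.mem_coeffs_iff.1 hc
    exact ⟨⟨_, hq m⟩, rfl⟩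
  obtain ⟨r, rfl⟩ := this
  rw [MvPolynomial.eval_map, ← MvPolynomial.aeval_def]
  intro h
  exact hq0 (by rw [hv.eq_zero_of_aeval_eq_zero r h, _root_.map_zero])

theorem MvPolynomial.exists_eval_snoc_eq_zero_s12 {L : Type*} [Field L] [IsAlgClosed L]
    (M : Subring L) {n : ℕ} {v : Fin n → L} (hv : AlgebraicIndependent M v)
    {p : MvPolynomial (Fin (n + 1)) L} (hp : ∀ m, p.coeff m ∈ M)
    (hdeg : 0 < p.degreeOf (Fin.last n)) :
    ∃ b, MvPolynomial.eval (Fin.snoc v b : Fin (n + 1) → L) p = 0 := by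
  set p' := MvPolynomial.rename (finRotate (n + 1)) p with hp'
  have hdeg' : (MvPolynomial.finSuccEquiv L n p').natDegree = p.degreeOf (Fin.last n) := by
    rw [MvPolynomial.natDegree_finSuccEquiv, ← finRotate_last,
      MvPolynomial.degreeOf_rename_of_injective (finRotate (n + 1)).injective]
  have hlead : MvPolynomial.eval v (MvPolynomial.finSuccEquiv L n p').leadingCoeff ≠ 0 := by
    refine MvPolynomial.eval_ne_zero_of_algebraicIndependent M hv (fun m ↦ ?_) fun h ↦ ?_
    · rw [Polynomial.leadingCoeff, MvPolynomial.finSuccEquiv_coeff_coeff]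
      by_cases h : p'.coeff (m.cons (MvPolynomial.finSuccEquiv L n p').natDegree) = 0
      · exact h ▸ zero_mem M
      · obtain ⟨u, hu, -⟩ := MvPolynomial.coeff_rename_ne_zero _ _ _ h
        rw [← hu, hp', MvPolynomial.coeff_rename_mapDomain _ (finRotate (n + 1)).injective]
        exact hp u
    · rw [Polynomial.leadingCoeff_eq_zero] at h
      rw [h, Polynomial.natDegree_zero] at hdeg'
      exact hdeg.ne hdeg'
  obtain ⟨b, hb⟩ := IsAlgClosed.exists_root
    ((MvPolynomial.finSuccEquiv L n p').map (MvPolynomial.eval v)) <| by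
      rw [Polynomial.degree_map_eq_of_leadingCoeff_ne_zero _ hlead]
      exact (Polynomial.natDegree_pos_iff_degree_pos.1 (hdeg' ▸ hdeg)).ne'
  refine ⟨b, ?_⟩
  rw [Polynomial.IsRoot.def, ← MvPolynomial.eval_eq_eval_mv_eval', hp', MvPolynomial.eval_rename]
    at hb
  convert hb using 3
  funext i
  refine Fin.lastCases ?_ (fun j ↦ ?_) i
  · simp
  · simp [Fin.coeSucc_eq_succ]

/-- If `x` is a transcendence basis, then any instance of Blum's axiom can be solved by a
derivation by prescribing its values on an infinite sequence of elements of the basis. -/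
theorem exists_prescription_of_blum {ι K L : Type*} [Field K] [Field L] [Algebra K L]
    [IsAlgClosed L] {x : ι → L} (hx : IsTranscendenceBasis K x) {y : ℕ → ι}
    (hy : Function.Injective y) {n : ℕ} {p : MvPolynomial (Fin (n + 1)) L}
    {q : MvPolynomial (Fin n) L} (hp : 0 < p.degreeOf (Fin.last n)) (hq : q ≠ 0) :
    ∃ g : ℕ → L, ∀ D : L → L, (∀ i, D (x (y i)) = g i) →
      ∃ a : L, MvPolynomial.eval (fun i : Fin (n + 1) => D^[(i : ℕ)] a) p = 0 ∧
        MvPolynomial.eval (fun i : Fin n => D^[(i : ℕ)] a) q ≠ 0 := by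
  classical
  choose s hs using exists_finset_isAlgebraic_adjoin hx
  let A : Finset ι := (p.coeffs ∪ q.coeffs).biUnion s
  obtain ⟨k, hk⟩ : ∃ k, ∀ i, y (k + i) ∉ A := by
    refine ⟨(A.preimage y hy.injOn).sup id + 1, fun i hi ↦ ?_⟩
    have := Finset.le_sup (f := id) (Finset.mem_preimage (hf := hy.injOn).2 hi)
    simp only [id] at this
    omega
  let R := Algebra.adjoin K (x '' A)
  let M : Subring L := (Subalgebra.algebraicClosure R L).toSubring
  have hM : ∀ c ∈ p.coeffs ∪ q.coeffs, c ∈ M := fun c hc ↦ by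
    change c ∈ Subalgebra.algebraicClosure R L
    rw [Subalgebra.mem_algebraicClosure]
    refine (hs c).tower_top_of_subalgebra_le (Algebra.adjoin_mono (Set.image_mono ?_))
    exact_mod_cast Finset.subset_biUnion_of_mem s hc
  have hpM (m) : p.coeff m ∈ M := by
    by_cases h : p.coeff m = 0
    · exact h ▸ zero_mem M
    · exact hM _ (Finset.mem_union_left _ (MvPolynomial.coeff_mem_coeffs m h))
  have hqM (m) : q.coeff m ∈ M := by
    by_cases h : q.coeff m = 0
    · exact h ▸ zero_mem M
    · exact hM _ (Finset.mem_union_right _ (MvPolynomial.coeff_mem_coeffs m h))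
  let v : Fin n → L := fun i ↦ x (y (k + i))
  have hv : AlgebraicIndependent M v := by
    have hdisj : Disjoint (A : Set ι) (Set.range fun i ↦ y (k + i)) := by
      rw [Set.disjoint_right]
      rintro _ ⟨i, rfl⟩
      exact hk i
    have := (hx.1.adjoin_of_disjoint hdisj).subalgebraAlgebraicClosure
    exact this.comp (fun i : Fin n ↦ ⟨_, i, rfl⟩) fun i j hij ↦
        Fin.ext (Nat.add_left_cancel (hy (Subtype.ext_iff.1 hij)))
  obtain ⟨b, hb⟩ := MvPolynomial.exists_eval_snoc_eq_zero_s12 M hv hpM hp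
  let z : ℕ → L := fun i ↦ if i < n then x (y (k + i)) else b
  refine ⟨fun j ↦ z (j - k + 1), fun D hD ↦ ⟨z 0, ?_⟩⟩
  have hz (i : ℕ) (hi : i ≤ n) : D^[i] (z 0) = z i := by
    induction i with
    | zero => rfl
    | succ i ih =>
      rw [Function.iterate_succ_apply', ih (by omega)]
      simp only [z]
      rw [if_pos (by omega), hD]
      simp [z]
  constructor
  · convert hb using 3
    funext i
    rw [hz i (by omega)]
    refine Fin.lastCases ?_ (fun j ↦ ?_) i <;> simp [z, v]
  · convert MvPolynomial.eval_ne_zero_of_algebraicIndependent M hv hqM hq using 3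
    funext i
    rw [hz i (by omega)]
    simp [z, v]

theorem isTranscendenceBasis_algebraicClosure (σ k : Type*) [Field k] :
    IsTranscendenceBasis k (algebraMap (FractionRing (MvPolynomial σ k))
      (AlgebraicClosure (FractionRing (MvPolynomial σ k))) ∘
        algebraMap (MvPolynomial σ k) (FractionRing (MvPolynomial σ k)) ∘ MvPolynomial.X) := by
  have : Algebra.IsAlgebraic (MvPolynomial σ k) (FractionRing (MvPolynomial σ k)) :=
    IsLocalization.isAlgebraic _ (nonZeroDivisors _)
  exact ((IsTranscendenceBasis.mvPolynomial σ k).algebraMap_comp).algebraMap_comp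

theorem exists_isDerivation_of_isTranscendenceBasis {ι K L : Type*} [Field K] [Field L]
    [CharZero K] [Algebra K L] {δ : K → K} (hδ : IsDerivation δ) {x : ι → L}
    (hx : IsTranscendenceBasis K x) (g : ι → L) :
    ∃ D : L → L, IsDerivation D ∧ (∀ a, algebraMap K L (δ a) = D (algebraMap K L a)) ∧
      ∀ i, D (x i) = g i := by
  have : CharZero L := charZero_of_injective_algebraMap (algebraMap K L).injective
  obtain ⟨s, hs⟩ := exists_isTranscendenceBasis ℚ K
  obtain ⟨D, hD⟩ := exists_derivation_of_isTranscendenceBasis (hs.sumElim_comp hx)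
    (Sum.elim g fun t ↦ algebraMap K L (δ t))
  have hD' : IsDerivation D := ⟨map_add D, fun a b ↦ by
    rw [D.leibniz, smul_eq_mul, smul_eq_mul]
    ring⟩
  refine ⟨D, hD', comm_of_isTranscendenceBasis hδ hD' (algebraMap K L) hs (fun a ↦ ?_)
    fun t ↦ (hD (.inr t)).symm, fun i ↦ hD (.inl i)⟩
  exact SubfieldClass.ratCast_mem (derivationEqualizer hδ hD' (algebraMap K L)) a

theorem exists_fin_isTranscendenceBasis {K F : Type*} [Field K] [Field F] [Algebra K F]
    (s : Finset F) (hs : Subfield.closure (Set.range (algebraMap K F) ∪ s) = ⊤) :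
    ∃ (r : ℕ) (a : Fin r → F), IsTranscendenceBasis K a := by
  have : Algebra.IsAlgebraic (Algebra.adjoin K (s : Set F)) F := by
    refine ⟨fun z ↦ ?_⟩
    have hz : z ∈ Subfield.closure (Set.range (algebraMap K F) ∪ s) := hs ▸ Subfield.mem_top z
    induction hz using Subfield.closure_induction with
    | mem z hz =>
      refine isAlgebraic_algebraMap (⟨z, ?_⟩ : Algebra.adjoin K (s : Set F))
      rcases hz with ⟨c, rfl⟩ | hz
      · exact algebraMap_mem _ c
      · exact Algebra.subset_adjoin hz
    | one => exact isAlgebraic_one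
    | add _ _ _ _ ha hb => exact ha.add hb
    | neg _ _ ha => exact ha.neg
    | inv _ _ ha => exact ha.inv
    | mul _ _ _ _ ha hb => exact ha.mul hb
  obtain ⟨t, ht, hb⟩ := exists_isTranscendenceBasis_subset (R := K) (s : Set F)
  have : Finite t := s.finite_toSet.subset ht
  exact ⟨_, _, (hb.comp_equiv (Finite.equivFin t).symm)⟩

open Cardinal in
theorem lift_mk_eq_of_isTranscendenceBasis {ι L : Type u} {K : Type v} [Field K] [Field L]
    {_ : Algebra K L} [IsAlgClosed L] [CharZero L] {x : ι → L} (hx : IsTranscendenceBasis K x) :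
    lift.{v} #L = max (max (lift.{u} #K) (lift.{v} #ι)) ℵ₀ := by
  refine le_antisymm ?_ ?_
  · have h := IsAlgClosed.cardinal_le_max_transcendence_basis x hx
    rwa [lift_umax.{u, v}] at h
  · have : Infinite L := CharZero.infinite L
    refine max_le (max_le ?_ (lift_le.2 (mk_le_of_injective hx.1.injective))) (by simp)
    exact lift_mk_le_lift_mk_of_injective (algebraMap K L).injective

open Cardinal in
theorem mk_sigma_mvPolynomial_le (L : Type u) [Field L] [Infinite L] :
    #(Σ n : ℕ, MvPolynomial (Fin (n + 1)) L × MvPolynomial (Fin n) L) ≤ #L := by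
  have hL : ℵ₀ ≤ #L := aleph0_le_mk L
  have h (n : ℕ) : #(MvPolynomial (Fin n) L) ≤ #L := by
    refine MvPolynomial.cardinalMk_le_max_lift.trans ?_
    simpa [hL] using natCast_le_aleph0.trans hL
  calc
    _ ≤ sum fun _ : ℕ ↦ #L := by
      rw [mk_sigma]
      refine sum_le_sum _ _ fun n ↦ ?_
      rw [mk_prod, lift_id, lift_id]
      exact (mul_le_mul' (h _) (h _)).trans (mul_eq_self hL).le
    _ = #L := by simp [aleph0_mul_eq hL]

theorem exists_surjective_of_mk_le {α β : Type u} [Nonempty β]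
    (h : Cardinal.mk β ≤ Cardinal.mk α) : ∃ f : α → β, Function.Surjective f :=
  have ⟨e⟩ := Cardinal.le_def _ _ |>.1 h
  ⟨_, Function.invFun_surjective e.injective⟩

open Cardinal in
theorem exists_isDiffClosed_universal {K : Type u} [Field K] [CharZero K] {δ : K → K}
    (hδ : IsDerivation δ) :
    ∃ (L : Type u) (_ : Field L) (_ : Algebra K L) (D : L → L), #L = #K ∧ IsDerivation D ∧
      IsDiffClosed D ∧ (∀ a, algebraMap K L (δ a) = D (algebraMap K L a)) ∧
      ∀ (F : Type u) [Field F] [Algebra K F] (δ₀ : F → F), IsDerivation δ₀ →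
        (∀ a, algebraMap K F (δ a) = δ₀ (algebraMap K F a)) →
        (∃ s : Finset F, Subfield.closure (Set.range (algebraMap K F) ∪ ↑s) = ⊤) →
        ∃ ψ : F →ₐ[K] L, ∀ z, ψ (δ₀ z) = D (ψ z) := by
  have : Infinite K := CharZero.infinite K
  have hK : ℵ₀ ≤ #K := aleph0_le_mk K
  let L := AlgebraicClosure (FractionRing (MvPolynomial ((K ⊕ K) × ℕ) K))
  let M := AlgebraicClosure (FractionRing (MvPolynomial (ULift.{u} ℕ) K))
  obtain ⟨x, hx⟩ : ∃ x : (K ⊕ K) × ℕ → L, IsTranscendenceBasis K x :=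
    ⟨_, isTranscendenceBasis_algebraicClosure _ K⟩
  obtain ⟨y, hy⟩ : ∃ y : ULift.{u} ℕ → M, IsTranscendenceBasis K y :=
    ⟨_, isTranscendenceBasis_algebraicClosure _ K⟩
  have : CharZero L := charZero_of_injective_algebraMap (algebraMap K L).injective
  have : CharZero M := charZero_of_injective_algebraMap (algebraMap K M).injective
  have : Infinite L := CharZero.infinite L
  have hL : #L = #K := by
    rw [← lift_id #L, lift_mk_eq_of_isTranscendenceBasis hx]
    simp [hK, add_eq_self]
  have hM : #M = #K := by
    rw [← lift_id #M, lift_mk_eq_of_isTranscendenceBasis hy]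
    simp [hK]
  obtain ⟨f₁, hf₁⟩ := exists_surjective_of_mk_le ((mk_sigma_mvPolynomial_le L).trans hL.le)
  obtain ⟨f₂, hf₂⟩ := exists_surjective_of_mk_le
    ((mk_list_le_max M).trans (max_le hK hM.le))
  have hg₁ (w : K) : ∃ g : ℕ → L, ∀ D : L → L, (∀ i, D (x (.inl w, i)) = g i) →
      0 < (f₁ w).2.1.degreeOf (Fin.last (f₁ w).1) → (f₁ w).2.2 ≠ 0 →
      ∃ a : L, MvPolynomial.eval (fun i : Fin ((f₁ w).1 + 1) ↦ D^[(i : ℕ)] a) (f₁ w).2.1 = 0 ∧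
        MvPolynomial.eval (fun i : Fin (f₁ w).1 ↦ D^[(i : ℕ)] a) (f₁ w).2.2 ≠ 0 := by
    by_cases h : 0 < (f₁ w).2.1.degreeOf (Fin.last (f₁ w).1) ∧ (f₁ w).2.2 ≠ 0
    · obtain ⟨g, hg⟩ := exists_prescription_of_blum hx
        (y := fun i ↦ (.inl w, i)) (fun i j hij ↦ congr(($hij).2)) h.1 h.2
      exact ⟨g, fun D hD _ _ ↦ hg D hD⟩
    · exact ⟨0, fun D _ h₁ h₂ ↦ (h ⟨h₁, h₂⟩).elim⟩
  choose g₁ hg₁ using hg₁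
  have hρ (w : K) : ∃ ρ : M →ₐ[K] L, ∀ i, ρ (y i) = x (.inr w, i.down) :=
    exists_algHom_apply_eq hy (hx.1.comp (fun i : ULift.{u} ℕ ↦ (.inr w, i.down))
      fun i j hij ↦ ULift.ext _ _ congr(($hij).2))
  choose ρ hρ using hρ
  obtain ⟨D, hD, hδD, hxD⟩ := exists_isDerivation_of_isTranscendenceBasis hδ hx
    fun s ↦ s.1.elim (fun w ↦ g₁ w s.2) fun w ↦ ρ w ((f₂ w).getD s.2 0)
  refine ⟨L, inferInstance, inferInstance, D, hL, hD, fun n p q hp hq ↦ ?_, hδD,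
    fun F _ _ δ₀ hδ₀ hδF ⟨s, hs⟩ ↦ ?_⟩
  · obtain ⟨w, hw⟩ := hf₁ ⟨n, p, q⟩
    have := hg₁ w D fun i ↦ hxD (.inl w, i)
    rw [hw] at this
    exact this hp hq
  · have : CharZero F := charZero_of_injective_algebraMap (algebraMap K F).injective
    obtain ⟨r, a, ha⟩ := exists_fin_isTranscendenceBasis s hs
    obtain ⟨φ, hφ⟩ := exists_algHom_apply_eq ha (hy.1.comp (fun i : Fin r ↦ ⟨i⟩)
      fun i j hij ↦ Fin.ext congr(($hij).down))
    obtain ⟨w, hw⟩ := hf₂ (List.ofFn fun i ↦ φ (δ₀ (a i)))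
    refine ⟨(ρ w).comp φ, comm_of_isTranscendenceBasis hδ₀ hD ((ρ w).comp φ : F →+* L) ha
      (fun c ↦ ?_) fun i ↦ ?_⟩
    · simp only [← hδF, RingHom.coe_coe, AlgHom.commutes, hδD]
    · have := hxD (.inr w, i)
      simp only [RingHom.coe_coe, AlgHom.comp_apply, hφ, Function.comp_apply, hρ, this]
      simp [hw]

/-- Every derivation on the algebraic closure `K` of `ℚ(X_t : t ∈ T₁)` (for `T₁` nonempty)
admits a differentially closed universal differential extension `(L, δ*)` of cardinality
`max (card T₁) ℵ₀`. -/
theorem statement12 {T₁ : Type u} [Nonempty T₁]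
    (δ : AlgebraicClosure (FractionRing (MvPolynomial T₁ ℚ)) →
      AlgebraicClosure (FractionRing (MvPolynomial T₁ ℚ)))
    (hder : IsDerivation δ) :
    Nonempty (UniversalDCFExtension T₁ δ) := by
  obtain ⟨L, _, _, D, hL, hD, hdcf, hδD, huniv⟩ := exists_isDiffClosed_universal hder
  refine ⟨L, D, algebraMap _ L, RingHom.injective _, hδD, hD, hdcf, ?_,
    fun F _ δ₀ j hδ₀ _ hj hs ↦ ?_⟩
  · rw [hL, ← Cardinal.lift_uzero (Cardinal.mk (AlgebraicClosure _)),
      lift_mk_eq_of_isTranscendenceBasis (isTranscendenceBasis_algebraicClosure T₁ ℚ)]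
    simp [max_comm]
  · let := j.toAlgebra
    obtain ⟨ψ, hψ⟩ := huniv F δ₀ hδ₀ hj hs
    exact ⟨ψ, RingHom.injective _, ψ.commutes, hψ⟩
end

section
/- Let K = ℝ or K = ℂ and m ≥ 1. For every nonzero polynomial P ∈ ℚ[x₁,…,x_m], the set W_P ⊆ K^m is unbounded, open, connected, and simply connected. -/
/-- The coefficient `ω(P) = P₀` of the highest power of the last variable `x_m` in
`P ∈ ℚ[x₁, …, x_m]`, a polynomial in the remaining variables (`ω(0) = 0`).  Here the
variables of `ℚ[x₁, …, x_{m+1}]` are indexed by `Fin (m + 1)`, the last variable being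
`Fin.last m`; `P` is rewritten as a univariate polynomial in the last variable via the
rotation `finRotate` followed by `MvPolynomial.finSuccEquiv`, and `ω(P)` is its leading
coefficient. -/
noncomputable def omegaPoly {m : ℕ} (P : MvPolynomial (Fin (m + 1)) ℚ) :
    MvPolynomial (Fin m) ℚ :=
  ((MvPolynomial.finSuccEquiv ℚ m) (MvPolynomial.rename (finRotate (m + 1)) P)).leadingCoeff

/-- The set `Γ_P = {λ ∈ K^m : P(λ₁, …, λ_{m−1}, λ_m + γ) = 0 for some real γ ≥ 0}`,
for `K = ℝ` or `K = ℂ` (an `RCLike` field). -/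
def GammaSet (K : Type*) [RCLike K] {m : ℕ} (P : MvPolynomial (Fin (m + 1)) ℚ) :
    Set (Fin (m + 1) → K) :=
  {x | ∃ γ : ℝ, 0 ≤ γ ∧
    MvPolynomial.aeval (Function.update x (Fin.last m) (x (Fin.last m) + algebraMap ℝ K γ)) P
      = 0}

/-- The sets `W_P ⊆ K^m` (`m ≥ 1`, indexing `K^m` by `Fin (m + 1)` with `m ≥ 0`), defined by
induction on the number of variables: `W_P = K ∖ Γ_P` in one variable, and
`W_P = (K^m ∖ Γ_P) ∩ (W_{ω(P)} × K)` in `m > 1` variables. -/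
noncomputable def WSet (K : Type*) [RCLike K] :
    (m : ℕ) → MvPolynomial (Fin (m + 1)) ℚ → Set (Fin (m + 1) → K)
  | 0, P => (GammaSet K P)ᶜ
  | m + 1, P =>
    (GammaSet K P)ᶜ ∩ {x | (fun i : Fin (m + 1) => x i.castSucc) ∈ WSet K m (omegaPoly P)}

open scoped unitInterval

/-- The fibre of `P` over a point `y` of `K^m`: the univariate polynomial `P(y, ·)`. -/
noncomputable def fiberPoly (K : Type*) [RCLike K] {m : ℕ} (P : MvPolynomial (Fin (m + 1)) ℚ)
    (y : Fin m → K) : Polynomial K :=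
  (MvPolynomial.finSuccEquiv ℚ m (MvPolynomial.rename (finRotate (m + 1)) P)).map
    (MvPolynomial.aeval (R := ℚ) y).toRingHom

/-- A bound for the norms of the roots of `P(y, ·)`, continuous in `y` wherever `ω(P)` does not
vanish. -/
noncomputable def rootBound {K : Type*} [RCLike K] {m : ℕ} (P : MvPolynomial (Fin (m + 1)) ℚ)
    (y : Fin m → K) : ℝ :=
  (∑ i ∈ Finset.range
      (MvPolynomial.finSuccEquiv ℚ m (MvPolynomial.rename (finRotate (m + 1)) P)).natDegree,
    ‖MvPolynomial.aeval (R := ℚ) y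
      ((MvPolynomial.finSuccEquiv ℚ m (MvPolynomial.rename (finRotate (m + 1)) P)).coeff i)‖ /
    ‖MvPolynomial.aeval (R := ℚ) y (omegaPoly P)‖) + 1

section

variable {K : Type*} [RCLike K] {m : ℕ} {P : MvPolynomial (Fin (m + 1)) ℚ}

theorem aeval_snoc_eq_eval_fiberPoly (P : MvPolynomial (Fin (m + 1)) ℚ) (y : Fin m → K) (t : K) :
    MvPolynomial.aeval (Fin.snoc y t : Fin (m + 1) → K) P = (fiberPoly K P y).eval t := by
  induction P using MvPolynomial.induction_on with
  | C a => simp [fiberPoly, MvPolynomial.finSuccEquiv_apply]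
  | add p q hp hq =>
    simp only [fiberPoly, map_add, Polynomial.map_add, Polynomial.eval_add] at *
    rw [hp, hq]
  | mul_X p i hp =>
    simp only [fiberPoly, map_mul, Polynomial.map_mul, Polynomial.eval_mul] at *
    rw [hp]
    congr 1
    refine Fin.lastCases ?_ (fun j => ?_) i
    · simp [MvPolynomial.finSuccEquiv_X_zero]
    · simp [MvPolynomial.finSuccEquiv_X_succ, Fin.coeSucc_eq_succ]

theorem mem_GammaSet_iff {x : Fin (m + 1) → K} :
    x ∈ GammaSet K P ↔ ∃ γ : ℝ, 0 ≤ γ ∧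
      (fiberPoly K P (Fin.init x)).eval (x (Fin.last m) + (γ : K)) = 0 := by
  simp only [GammaSet, Set.mem_ofPred_eq, ← aeval_snoc_eq_eval_fiberPoly]
  refine exists_congr fun γ => and_congr_right fun _ => ?_
  have h : Function.update x (Fin.last m) (x (Fin.last m) + (γ : K)) =
      Fin.snoc (Fin.init x) (x (Fin.last m) + (γ : K)) := by
    conv_lhs => rw [← Fin.snoc_init_self x]
    simp only [Fin.update_snoc_last, Fin.snoc_last]
  exact Eq.congr_left (by rw [← h])

theorem norm_lt_rootBound {y : Fin m → K} {t : K}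
    (hy : MvPolynomial.aeval y (omegaPoly P) ≠ 0) (ht : (fiberPoly K P y).eval t = 0) :
    ‖t‖ < rootBound P y := by
  set F := MvPolynomial.finSuccEquiv ℚ m (MvPolynomial.rename (finRotate (m + 1)) P) with hF
  have hlead : (MvPolynomial.aeval (R := ℚ) y).toRingHom F.leadingCoeff ≠ 0 := hy
  have hdeg : (fiberPoly K P y).natDegree = F.natDegree :=
    Polynomial.natDegree_map_of_leadingCoeff_ne_zero _ hlead
  have hlc : (fiberPoly K P y).leadingCoeff = MvPolynomial.aeval (R := ℚ) y (omegaPoly P) :=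
    Polynomial.leadingCoeff_map_of_leadingCoeff_ne_zero _ hlead
  have hne : fiberPoly K P y ≠ 0 := by
    rw [← Polynomial.leadingCoeff_ne_zero, hlc]
    exact hy
  have hbound := Polynomial.IsRoot.norm_lt_cauchyBound hne ht
  have hle : ((fiberPoly K P y).cauchyBound : ℝ) ≤ rootBound P y := by
    simp only [Polynomial.cauchyBound, rootBound, NNReal.coe_add, NNReal.coe_div, coe_nnnorm,
      NNReal.coe_one, hlc, hdeg, ← Finset.sum_div]
    gcongr
    have : (Finset.range F.natDegree).sup (fun i => ‖(fiberPoly K P y).coeff i‖₊) ≤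
        ∑ i ∈ Finset.range F.natDegree, ‖(fiberPoly K P y).coeff i‖₊ :=
      Finset.sup_le fun i hi =>
        Finset.single_le_sum (f := fun i => ‖(fiberPoly K P y).coeff i‖₊) (fun _ _ => zero_le) hi
    have h2 := NNReal.coe_le_coe.2 this
    simpa [fiberPoly, Polynomial.coeff_map] using h2
  exact (NNReal.coe_lt_coe.2 hbound).trans_le hle

theorem continuous_aeval_mvPolynomial {n : ℕ} (p : MvPolynomial (Fin n) ℚ) :
    Continuous fun x : Fin n → K => MvPolynomial.aeval x p := by
  induction p using MvPolynomial.induction_on with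
  | C a => simpa using continuous_const
  | add p q hp hq =>
    simp only [map_add]
    exact hp.add hq
  | mul_X p i hp =>
    simp only [map_mul, MvPolynomial.aeval_X]
    exact hp.mul (continuous_apply i)

theorem continuousOn_rootBound :
    ContinuousOn (rootBound P : (Fin m → K) → ℝ)
      {y | MvPolynomial.aeval y (omegaPoly P) ≠ 0} := by
  unfold rootBound
  refine ContinuousOn.add (continuousOn_finsetSum _ fun i _ => ?_) continuousOn_const
  exact (continuous_aeval_mvPolynomial _).norm.continuousOn.div
    (continuous_aeval_mvPolynomial _).norm.continuousOn fun y hy => norm_ne_zero_iff.2 hy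

theorem continuous_init : Continuous fun x : Fin (m + 1) → K => (Fin.init x : Fin m → K) :=
  continuous_pi fun i => continuous_apply i.castSucc

theorem continuous_snoc {X : Type*} [TopologicalSpace X] {f : X → Fin m → K} {g : X → K}
    (hf : Continuous f) (hg : Continuous g) :
    Continuous fun x => (Fin.snoc (f x) (g x) : Fin (m + 1) → K) :=
  Continuous.finSnoc hf hg

theorem continuous_eval_fiberPoly :
    Continuous fun z : (Fin (m + 1) → K) × ℝ =>
      (fiberPoly K P (Fin.init z.1)).eval (z.1 (Fin.last m) + (z.2 : K)) := by
  simp only [← aeval_snoc_eq_eval_fiberPoly]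
  refine (continuous_aeval_mvPolynomial P).comp ?_
  refine continuous_snoc (continuous_init.comp continuous_fst) ?_
  exact ((continuous_apply _).comp continuous_fst).add (RCLike.continuous_ofReal.comp continuous_snd)

theorem snoc_mem_compl_GammaSet {y : Fin m → K} {t : K}
    (hy : MvPolynomial.aeval y (omegaPoly P) ≠ 0) (ht : rootBound P y ≤ RCLike.re t) :
    (Fin.snoc y t : Fin (m + 1) → K) ∈ (GammaSet K P)ᶜ := by
  rw [Set.mem_compl_iff, mem_GammaSet_iff]
  rintro ⟨γ, hγ, h⟩
  simp only [Fin.init_snoc, Fin.snoc_last] at h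
  have h1 := norm_lt_rootBound hy h
  have h2 := RCLike.re_le_norm (t + (γ : K))
  simp only [map_add, RCLike.ofReal_re] at h2
  linarith

theorem snoc_add_mem_compl_GammaSet {x : Fin (m + 1) → K} (hx : x ∈ (GammaSet K P)ᶜ) {c : ℝ}
    (hc : 0 ≤ c) :
    (Fin.snoc (Fin.init x) (x (Fin.last m) + (c : K)) : Fin (m + 1) → K) ∈ (GammaSet K P)ᶜ := by
  rw [Set.mem_compl_iff, mem_GammaSet_iff] at hx ⊢
  rintro ⟨γ, hγ, h⟩
  refine hx ⟨c + γ, add_nonneg hc hγ, ?_⟩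
  simpa [add_assoc] using h

/-- The part of `K^{m+1} ∖ Γ_P` lying over a subset `B` of `K^m`. -/
def overSet (P : MvPolynomial (Fin (m + 1)) ℚ) (B : Set (Fin m → K)) : Set (Fin (m + 1) → K) :=
  (GammaSet K P)ᶜ ∩ {x | (Fin.init x : Fin m → K) ∈ B}

variable {B : Set (Fin m → K)}

theorem isOpen_overSet (hB : IsOpen B) (hω : ∀ y ∈ B, MvPolynomial.aeval y (omegaPoly P) ≠ 0) :
    IsOpen (overSet P B) := by
  rw [isOpen_iff_mem_nhds]
  rintro x ⟨hxΓ, hxB⟩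
  set C : ℝ := rootBound P (Fin.init x) + ‖x (Fin.last m)‖ + 1
  have h1 : ∀ᶠ z in nhds x, (Fin.init z : Fin m → K) ∈ B :=
    continuous_init.continuousAt.eventually (hB.mem_nhds hxB)
  have hcont : ContinuousAt (fun z : Fin (m + 1) → K =>
      rootBound P (Fin.init z) + ‖z (Fin.last m)‖) x := by
    refine ContinuousAt.add ?_ (continuous_apply _).norm.continuousAt
    have : ContinuousAt (rootBound P : (Fin m → K) → ℝ) (Fin.init x) :=
      (continuousOn_rootBound.mono hω).continuousAt (hB.mem_nhds hxB)
    exact ContinuousAt.comp (f := fun z : Fin (m + 1) → K => (Fin.init z : Fin m → K)) this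
      continuous_init.continuousAt
  have h2 : ∀ᶠ z in nhds x, rootBound P (Fin.init z) + ‖z (Fin.last m)‖ < C :=
    hcont.eventually (gt_mem_nhds (lt_add_one _))
  have h3 : ∀ᶠ z in nhds x, ∀ γ ∈ Set.Icc (0 : ℝ) C,
      (fiberPoly K P (Fin.init z)).eval (z (Fin.last m) + (γ : K)) ≠ 0 := by
    refine isCompact_Icc.eventually_forall_of_forall_eventually fun γ hγ => ?_
    refine continuous_eval_fiberPoly.continuousAt.eventually_ne fun h => hxΓ ?_
    exact mem_GammaSet_iff.2 ⟨γ, hγ.1, h⟩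
  filter_upwards [h1, h2, h3] with z hz1 hz2 hz3
  refine ⟨fun hz => ?_, hz1⟩
  obtain ⟨γ, hγ, h⟩ := mem_GammaSet_iff.1 hz
  refine hz3 γ ⟨hγ, ?_⟩ h
  have h4 := norm_lt_rootBound (hω _ hz1) h
  have h5 : ‖(γ : K)‖ ≤ ‖z (Fin.last m) + (γ : K)‖ + ‖z (Fin.last m)‖ := by
    simpa using norm_sub_le (z (Fin.last m) + (γ : K)) (z (Fin.last m))
  rw [RCLike.norm_of_nonneg hγ] at h5
  linarith

theorem not_isBounded_overSet (hB : B.Nonempty)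
    (hω : ∀ y ∈ B, MvPolynomial.aeval y (omegaPoly P) ≠ 0) :
    ¬Bornology.IsBounded (overSet P B) := by
  intro hb
  obtain ⟨y, hy⟩ := hB
  obtain ⟨C, hC⟩ := hb.exists_norm_le
  set r : ℝ := max (rootBound P y) (C + 1)
  have hmem : (Fin.snoc y (r : K) : Fin (m + 1) → K) ∈ overSet P B :=
    ⟨snoc_mem_compl_GammaSet (hω y hy) (by simp [r]), by simpa using hy⟩
  have h1 := (norm_le_pi_norm _ (Fin.last m)).trans (hC _ hmem)
  have h2 := RCLike.re_le_norm (r : K)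
  simp only [Fin.snoc_last, RCLike.ofReal_re] at h1 h2
  have h3 : C + 1 ≤ r := le_max_right _ _
  linarith

theorem contractibleSpace_overSet [ContractibleSpace B]
    (hω : ∀ y ∈ B, MvPolynomial.aeval y (omegaPoly P) ≠ 0) :
    ContractibleSpace (overSet P B) := by
  have hR : Continuous fun y : B => rootBound P (y : Fin m → K) :=
    (continuousOn_rootBound.mono hω).comp_continuous continuous_subtype_val fun y => y.2
  let p : C(overSet P B, B) :=
    ⟨fun x => ⟨Fin.init x.1, x.2.2⟩, (continuous_init.comp continuous_subtype_val).subtype_mk _⟩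
  have hinit : Continuous fun x : overSet P B => (Fin.init x.1 : Fin m → K) :=
    continuous_init.comp continuous_subtype_val
  have hRp : Continuous fun x : overSet P B => rootBound P (Fin.init x.1 : Fin m → K) :=
    (continuousOn_rootBound.mono hω).comp_continuous hinit fun x => x.2.2
  have hlast : Continuous fun x : overSet P B => x.1 (Fin.last m) :=
    (continuous_apply _).comp continuous_subtype_val
  have hs : Continuous fun y : B =>
      (Fin.snoc (y : Fin m → K) (rootBound P (y : Fin m → K) : K) : Fin (m + 1) → K) :=
    continuous_snoc continuous_subtype_val (RCLike.continuous_ofReal.comp hR)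
  let s : C(B, overSet P B) :=
    ⟨fun y => ⟨Fin.snoc y.1 (rootBound P y.1 : K),
      snoc_mem_compl_GammaSet (hω _ y.2) (by simp), by simp⟩,
      hs.subtype_mk _⟩
  -- The translation amount pushing a point of the fibre into the half-plane free of roots.
  let c : overSet P B → ℝ := fun x => |rootBound P (Fin.init x.1 : Fin m → K)| + ‖x.1 (Fin.last m)‖
  have hc : Continuous c := hRp.abs.add hlast.norm
  have hc0 : ∀ x, 0 ≤ c x := fun x => by positivity
  have hcre : ∀ x, rootBound P (Fin.init x.1 : Fin m → K) ≤ RCLike.re (x.1 (Fin.last m) + (c x : K)) := by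
    intro x
    have h1 := neg_le_of_abs_le (RCLike.abs_re_le_norm (x.1 (Fin.last m)))
    have h2 := le_abs_self (rootBound P (Fin.init x.1 : Fin m → K))
    simp only [map_add, RCLike.ofReal_re, c]
    linarith
  let q : C(overSet P B, overSet P B) :=
    ⟨fun x => ⟨Fin.snoc (Fin.init x.1) (x.1 (Fin.last m) + (c x : K)),
      snoc_add_mem_compl_GammaSet x.2.1 (hc0 x), by simpa using x.2.2⟩,
      (continuous_snoc hinit
        (hlast.add (RCLike.continuous_ofReal.comp hc))).subtype_mk _⟩
  have translate : (ContinuousMap.id (overSet P B)).Homotopic q := by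
    refine ⟨⟨⟨fun z => ⟨Fin.snoc (Fin.init z.2.1)
      (z.2.1 (Fin.last m) + (((z.1 : ℝ) * c z.2 : ℝ) : K)),
      snoc_add_mem_compl_GammaSet z.2.2.1 (mul_nonneg z.1.2.1 (hc0 _)),
      by simpa using z.2.2.2⟩, ?_⟩, ?_, ?_⟩⟩
    · refine (continuous_snoc (hinit.comp continuous_snd)
        ((hlast.comp continuous_snd).add (RCLike.continuous_ofReal.comp ?_))).subtype_mk _
      exact (continuous_subtype_val.comp continuous_fst).mul (hc.comp continuous_snd)
    · intro x
      ext1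
      simp
    · intro x
      ext1
      simp [q]
  have contract : q.Homotopic (s.comp p) := by
    refine ⟨⟨⟨fun z => ⟨Fin.snoc (Fin.init z.2.1)
      (((1 - z.1 : ℝ) : K) * (z.2.1 (Fin.last m) + (c z.2 : K)) +
        (((z.1 : ℝ) * rootBound P (Fin.init z.2.1 : Fin m → K) : ℝ) : K)),
      snoc_mem_compl_GammaSet (hω _ z.2.2.2) ?_, by simpa using z.2.2.2⟩, ?_⟩, ?_, ?_⟩⟩
    · have h1 := mul_le_mul_of_nonneg_left (hcre z.2) (sub_nonneg.2 z.1.2.2)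
      rw [map_add, RCLike.re_ofReal_mul, RCLike.ofReal_re]
      linarith
    · have h1 : Continuous fun z : I × overSet P B => (z.1 : ℝ) :=
        continuous_subtype_val.comp continuous_fst
      refine (continuous_snoc (hinit.comp continuous_snd)
        (((RCLike.continuous_ofReal.comp (continuous_const.sub h1)).mul
          ((hlast.add (RCLike.continuous_ofReal.comp hc)).comp continuous_snd)).add
          (RCLike.continuous_ofReal.comp (h1.mul (hRp.comp continuous_snd))))).subtype_mk _
    · intro x
      ext1
      simp [q]
    · intro x
      ext1
      simp [s, p]
  have hps : p.comp s = ContinuousMap.id B := by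
    ext1 y
    ext1
    simp [p, s]
  let e : ContinuousMap.HomotopyEquiv (overSet P B) B :=
    ⟨p, s, (translate.trans contract).symm, by rw [hps]⟩
  exact e.contractibleSpace

theorem omegaPoly_ne_zero (hP : P ≠ 0) : omegaPoly P ≠ 0 := by
  rw [omegaPoly, Polynomial.leadingCoeff_ne_zero]
  simpa [(MvPolynomial.rename_injective _ (finRotate (m + 1)).injective).eq_iff' (map_zero _)]
    using hP

theorem aeval_ne_zero_of_mem_WSet {x : Fin (m + 1) → K} (hx : x ∈ WSet K m P) :
    MvPolynomial.aeval x P ≠ 0 := by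
  have hΓ : x ∈ (GammaSet K P)ᶜ := by
    cases m with
    | zero => exact hx
    | succ m => exact hx.1
  exact fun h => hΓ ⟨0, le_rfl, by simpa using h⟩

theorem WSet_zero (P : MvPolynomial (Fin 1) ℚ) : WSet K 0 P = overSet P Set.univ := by
  simp [WSet, overSet]

theorem WSet_succ (P : MvPolynomial (Fin (m + 2)) ℚ) :
    WSet K (m + 1) P = overSet P (WSet K m (omegaPoly P)) :=
  rfl

theorem aeval_fin_zero_ne_zero {p : MvPolynomial (Fin 0) ℚ} (hp : p ≠ 0) (y : Fin 0 → K) :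
    MvPolynomial.aeval y p ≠ 0 := by
  obtain ⟨a, rfl⟩ := MvPolynomial.C_surjective (Fin 0) p
  simpa using hp

theorem WSet_isOpen_and_contractibleSpace (hP : P ≠ 0) :
    ¬Bornology.IsBounded (WSet K m P) ∧ IsOpen (WSet K m P) ∧
      ContractibleSpace (WSet K m P) := by
  induction m with
  | zero =>
    have hω : ∀ y ∈ (Set.univ : Set (Fin 0 → K)), MvPolynomial.aeval y (omegaPoly P) ≠ 0 :=
      fun y _ => aeval_fin_zero_ne_zero (omegaPoly_ne_zero hP) y
    have : ContractibleSpace (Set.univ : Set (Fin 0 → K)) :=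
      (Homeomorph.Set.univ (Fin 0 → K)).contractibleSpace
    rw [WSet_zero]
    exact ⟨not_isBounded_overSet Set.univ_nonempty hω, isOpen_overSet isOpen_univ hω,
      contractibleSpace_overSet hω⟩
  | succ m ih =>
    obtain ⟨-, hopen, hcontr⟩ := ih (omegaPoly_ne_zero hP)
    have hω : ∀ y ∈ WSet K m (omegaPoly P), MvPolynomial.aeval y (omegaPoly P) ≠ 0 :=
      fun y hy => aeval_ne_zero_of_mem_WSet hy
    have hne : (WSet K m (omegaPoly P)).Nonempty := Set.nonempty_coe_sort.1 inferInstance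
    rw [WSet_succ]
    exact ⟨not_isBounded_overSet hne hω, isOpen_overSet hopen hω, contractibleSpace_overSet hω⟩

end

/-- Properties R2 and R3 of the sets `W_P`: for nonzero `P`, the set `W_P ⊆ K^m` is
unbounded, open, connected and simply connected. -/
theorem statement17 {K : Type*} [RCLike K] (m : ℕ) (P : MvPolynomial (Fin (m + 1)) ℚ)
    (hP : P ≠ 0) :
    ¬Bornology.IsBounded (WSet K m P) ∧ IsOpen (WSet K m P) ∧
    IsConnected (WSet K m P) ∧ SimplyConnectedSpace ↥(WSet K m P) := by
  obtain ⟨hunb, hopen, hcontr⟩ := WSet_isOpen_and_contractibleSpace (K := K) hP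
  exact ⟨hunb, hopen, isConnected_iff_connectedSpace.2 inferInstance, inferInstance⟩
end

section
/- Let K = ℝ or K = ℂ, let 1 ≤ i₁ < i₂ < ⋯ < i_m ≤ n, let P ∈ ℚ[y₁,…,y_m], and let Q ∈ ℚ[x₁,…,xₙ] be the polynomial defined by Q(x₁,…,xₙ) = P(x_{i₁},…,x_{i_m}). Then W_Q ⊆ {(x₁,…,xₙ) ∈ Kⁿ : (x_{i₁},…,x_{i_m}) ∈ W_P}, where W_P ⊆ K^m and W_Q ⊆ Kⁿ. -/
open MvPolynomial in
/-- Renaming commutes with viewing a polynomial as univariate in its last variable, when the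
renaming fixes the last variable. -/
theorem finSuccEquiv_finRotate_rename {m n : ℕ} (F : Fin (m + 1) → Fin (n + 1))
    (g : Fin m → Fin n) (hF : ∀ i, F i.castSucc = (g i).castSucc)
    (hlast : F (Fin.last m) = Fin.last n) (P : MvPolynomial (Fin (m + 1)) ℚ) :
    finSuccEquiv ℚ n (rename (finRotate (n + 1)) (rename F P)) =
      ((finSuccEquiv ℚ m) (rename (finRotate (m + 1)) P)).map (rename g).toRingHom := by
  induction P using MvPolynomial.induction_on with
  | C a => simp [finSuccEquiv_apply]
  | add p q hp hq => simp only [map_add, hp, hq, Polynomial.map_add]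
  | mul_X p i hp =>
    simp only [map_mul, hp, Polynomial.map_mul, rename_X]
    congr 1
    induction i using Fin.lastCases with
    | last => simp [hlast, finSuccEquiv_X_zero]
    | cast i => simp [hF, Fin.coeSucc_eq_succ, finSuccEquiv_X_succ]

open MvPolynomial in
theorem omegaPoly_rename_of_last {m n : ℕ} (F : Fin (m + 1) → Fin (n + 1))
    (g : Fin m → Fin n) (hg : Function.Injective g) (hF : ∀ i, F i.castSucc = (g i).castSucc)
    (hlast : F (Fin.last m) = Fin.last n) (P : MvPolynomial (Fin (m + 1)) ℚ) :
    omegaPoly (rename F P) = rename g (omegaPoly P) := by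
  unfold omegaPoly
  rw [finSuccEquiv_finRotate_rename F g hF hlast,
    Polynomial.leadingCoeff_map_of_injective (rename_injective g hg)]
  rfl

open MvPolynomial in
/-- A polynomial that does not involve the last variable is its own leading coefficient. -/
theorem omegaPoly_rename_castSucc {n : ℕ} (P : MvPolynomial (Fin n) ℚ) :
    omegaPoly (rename Fin.castSucc P) = P := by
  have h : finSuccEquiv ℚ n (rename (finRotate (n + 1)) (rename Fin.castSucc P)) =
      Polynomial.C P := by
    induction P using MvPolynomial.induction_on with
    | C a => simp [finSuccEquiv_apply]
    | add p q hp hq => simp only [map_add, hp, hq]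
    | mul_X p i hp =>
      simp only [map_mul, hp, rename_X]
      simp [Fin.coeSucc_eq_succ, finSuccEquiv_X_succ]
  rw [omegaPoly, h, Polynomial.leadingCoeff_C]

theorem mem_GammaSet_rename {K : Type*} [RCLike K] {m n : ℕ} (f : Fin (m + 1) → Fin (n + 1))
    (hf : Function.Injective f) (hlast : f (Fin.last m) = Fin.last n)
    (P : MvPolynomial (Fin (m + 1)) ℚ) (x : Fin (n + 1) → K) :
    x ∈ GammaSet K (MvPolynomial.rename f P) ↔ (fun i => x (f i)) ∈ GammaSet K P := by
  have h (a : K) : Function.update x (Fin.last n) a ∘ f =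
      Function.update (fun i => x (f i)) (Fin.last m) a := by
    rw [← hlast, Function.update_comp_eq_of_injective x hf]
    rfl
  simp only [GammaSet, Set.mem_ofPred_eq, MvPolynomial.aeval_rename, h, hlast]

theorem WSet_subset_compl_GammaSet (K : Type*) [RCLike K] (m : ℕ)
    (P : MvPolynomial (Fin (m + 1)) ℚ) : WSet K m P ⊆ (GammaSet K P)ᶜ := by
  cases m with
  | zero => exact subset_rfl
  | succ m => exact Set.inter_subset_left

/-- If `Q ∈ ℚ[x₁, …, xₙ]` arises from `P ∈ ℚ[y₁, …, y_m]` by the substitution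
`Q(x₁, …, xₙ) = P(x_{i₁}, …, x_{i_m})` along a strictly increasing choice of indices
`i₁ < ⋯ < i_m` (encoded by a strictly monotone map `f`), then
`W_Q ⊆ {x ∈ Kⁿ : (x_{i₁}, …, x_{i_m}) ∈ W_P}`. -/
theorem statement19 {K : Type*} [RCLike K] (m n : ℕ) (f : Fin (m + 1) → Fin (n + 1))
    (hf : StrictMono f) (P : MvPolynomial (Fin (m + 1)) ℚ)
    (Q : MvPolynomial (Fin (n + 1)) ℚ) (hQ : Q = MvPolynomial.rename f P) :
    WSet K n Q ⊆ {x | (fun i : Fin (m + 1) => x (f i)) ∈ WSet K m P} := by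
  subst hQ
  intro x hx
  induction n generalizing m with
  | zero =>
    obtain rfl : m = 0 := by
      have := Fintype.card_le_of_injective f hf.injective
      simpa using this
    have hlast : f (Fin.last 0) = Fin.last 0 := Subsingleton.elim (α := Fin 1) _ _
    exact fun h => hx ((mem_GammaSet_rename f hf.injective hlast P x).2 h)
  | succ n ih =>
    by_cases hlast : f (Fin.last m) = Fin.last (n + 1)
    · have hΓ : (fun i => x (f i)) ∈ (GammaSet K P)ᶜ := fun h =>
        WSet_subset_compl_GammaSet K _ _ hx
          ((mem_GammaSet_rename f hf.injective hlast P x).2 h)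
      cases m with
      | zero => exact hΓ
      | succ m =>
        have hne (i : Fin (m + 1)) : f i.castSucc ≠ Fin.last (n + 1) :=
          (hlast ▸ hf (Fin.castSucc_lt_last i)).ne
        have hg : StrictMono fun i : Fin (m + 1) => (f i.castSucc).castPred (hne i) :=
          fun i j hij => Fin.castPred_lt_castPred_iff.2 (hf (Fin.castSucc_lt_castSucc_iff.2 hij))
        have hω := omegaPoly_rename_of_last f _ hg.injective
          (fun i => (Fin.castSucc_castPred _ (hne i)).symm) hlast P
        have hx' := hx.2
        rw [Set.mem_ofPred_eq, hω] at hx'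
        refine ⟨hΓ, ?_⟩
        simpa using ih m _ hg (omegaPoly P) hx'
    · have hne (i : Fin (m + 1)) : f i ≠ Fin.last (n + 1) :=
        ((hf.monotone (Fin.le_last i)).trans_lt (Fin.lt_last_iff_ne_last.2 hlast)).ne
      have hg : StrictMono fun i => (f i).castPred (hne i) :=
        fun i j hij => Fin.castPred_lt_castPred_iff.2 (hf hij)
      have hω : omegaPoly (MvPolynomial.rename f P) =
          MvPolynomial.rename (fun i => (f i).castPred (hne i)) P := by
        rw [← omegaPoly_rename_castSucc (MvPolynomial.rename (fun i => (f i).castPred (hne i)) P),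
          MvPolynomial.rename_rename]
        rfl
      have hx' := hx.2
      rw [Set.mem_ofPred_eq, hω] at hx'
      simpa using ih m _ hg P hx'
end
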